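/- Let A_1, …, A_m be pairwise disjoint compact connected sets in ℂ, each with connected complement and diameter less than ε. Then for every closed nowhere dense set E ⊆ ℂ there exists a homeomorphism φ : ℂ → ℂ with sup_{z∈ℂ} |φ(z) − z| < ε such that φ(E) is disjoint from ⋃_{i=1}^m A_i. -/

import Mathlib

open Metric
open scoped Topology

/-- `X` can be pushed into any neighbourhood of `Y` by homeomorphisms of the plane supported
in `U`. -/
def ShrinksIn (U X Y : Set ℂ) : Prop :=
  ∀ W, IsOpen W → Y ⊆ W → ∃ h : ℂ ≃ₜ ℂ, (∀ z ∉ U, h z = z) ∧ Set.MapsTo h X W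

lemma ShrinksIn.refl (U X : Set ℂ) : ShrinksIn U X X := fun _ _ hW =>
  ⟨Homeomorph.refl ℂ, fun _ _ => rfl, fun _ hz => hW hz⟩

lemma ShrinksIn.mono {U X Y Y' : Set ℂ} (h : ShrinksIn U X Y) (hY : Y ⊆ Y') :
    ShrinksIn U X Y' := fun W hW hYW => h W hW (hY.trans hYW)

lemma ShrinksIn.trans {U X Y Z : Set ℂ} (h₁ : ShrinksIn U X Y) (h₂ : ShrinksIn U Y Z) :
    ShrinksIn U X Z := by
  intro W hW hZ
  obtain ⟨g, hg, hgW⟩ := h₂ W hW hZ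
  obtain ⟨f, hf, hfW⟩ := h₁ (g ⁻¹' W) (hW.preimage g.continuous) hgW
  exact ⟨f.trans g, fun z hz => by simp [hf z hz, hg z hz], fun z hz => hfW hz⟩

lemma ShrinksIn.preimage {U X Y : Set ℂ} (g : ℂ ≃ₜ ℂ) (h : ShrinksIn U X Y) :
    ShrinksIn (g ⁻¹' U) (g ⁻¹' X) (g ⁻¹' Y) := by
  intro W hW hY
  obtain ⟨f, hf, hfW⟩ := h (g.symm ⁻¹' W) (hW.preimage g.symm.continuous)
    fun z hz => hY (by simpa using hz)
  exact ⟨(g.trans f).trans g.symm, fun z hz => by simp [hf (g z) hz], fun z hz => hfW hz⟩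

/-- The homeomorphism moving each point of `S` in the direction `v`, by an amount proportional to
its distance from the complement of `S`. -/
lemma exists_homeomorph_add_infDist_smul (S : Set ℂ) {v : ℂ} (hv : ‖v‖ < 1) :
    ∃ h : ℂ ≃ₜ ℂ, ∀ z, h z = z + infDist z Sᶜ • v := by
  have happ : ApproximatesLinearOn (fun z : ℂ => z + infDist z Sᶜ • v)
      ((ContinuousLinearEquiv.refl ℝ ℂ : ℂ ≃L[ℝ] ℂ) : ℂ →L[ℝ] ℂ) Set.univ ‖v‖₊ := by
    rw [ApproximatesLinearOn.approximatesLinearOn_iff_lipschitzOnWith]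
    refine LipschitzOnWith.of_dist_le_mul fun x _ y _ => ?_
    have h1 := (lipschitz_infDist_pt Sᶜ).dist_le_mul x y
    have : dist (infDist x Sᶜ • v) (infDist y Sᶜ • v) ≤ ‖v‖ * dist x y := by
      rw [dist_eq_norm, ← sub_smul, norm_smul, mul_comm]
      rw [Real.dist_eq] at h1
      simpa using mul_le_mul_of_nonneg_left h1 (norm_nonneg v)
    simpa using this
  refine ⟨happ.toHomeomorph _ (Or.inr ?_), fun z => rfl⟩
  have : ‖(((ContinuousLinearEquiv.refl ℝ ℂ : ℂ ≃L[ℝ] ℂ).symm : ℂ ≃L[ℝ] ℂ) : ℂ →L[ℝ] ℂ)‖₊ = 1 := by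
    ext
    exact ContinuousLinearMap.norm_id (𝕜 := ℝ) (E := ℂ)
  rw [this]
  simpa [← NNReal.coe_lt_coe] using hv

open scoped Pointwise in
/-- Flowing in the direction `-d` inside the open set `S` empties `X ∩ S`, provided that inside a
compact set `T ⊇ S` the set `X` contains its shadow in that direction, and that points of `X` on
the boundary of `S` do not flow back into `S`. -/
lemma shrinksIn_diff_of_shadow {S T U X : Set ℂ} {d : ℂ} (hd : ‖d‖ = 1) (hS : IsOpen S)
    (hT : IsCompact T) (hST : S ⊆ T) (hU : IsOpen U) (hX : IsCompact X) (hXU : X ⊆ U)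
    (hshadow : ∀ z ∈ X, z ∈ T → ∀ t : ℝ, 0 ≤ t → z - t • d ∈ T → z - t • d ∈ X)
    (hexit : ∀ z ∈ X, z ∈ T → z ∉ S → ∀ t : ℝ, 0 ≤ t → z - t • d ∉ S) :
    ShrinksIn U X (X \ S) := by
  intro W hW hXW
  set S' := S ∩ U with hS'
  have hS'o : IsOpen S' := hS.inter hU
  have hd0 : d ≠ 0 := by rintro rfl; simp at hd
  have hne : (S'ᶜ).Nonempty := by
    rw [Set.nonempty_compl]
    intro h
    have : S = Set.univ := Set.eq_univ_of_univ_subset (h ▸ Set.inter_subset_left)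
    exact noncompact_univ ℂ (Set.eq_univ_of_univ_subset (this ▸ hST) ▸ hT)
  obtain ⟨F, hF⟩ := exists_homeomorph_add_infDist_smul S' (v := (-(1/2 : ℝ)) • d) (by
    rw [norm_smul, hd]; norm_num)
  set ρ : ℂ → ℝ := fun z => infDist z S'ᶜ with hρ
  have hρ0 : ∀ z, 0 ≤ ρ z := fun z => infDist_nonneg
  have hF' : ∀ z, F z = z - (ρ z / 2) • d := fun z => by
    rw [hF, smul_smul, sub_eq_add_neg, ← neg_smul]; congr 2; simp only [hρ]; ring
  have hfix : ∀ z ∉ S', F z = z := fun z hz => by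
    rw [hF, infDist_zero_of_mem hz]; simp
  have hFS : ∀ z ∈ S', F z ∈ S' := fun z hz => by
    by_contra h
    exact h (by rw [F.injective (hfix _ h)]; exact hz)
  -- points whose whole shadow in `T` lies in `W`
  set W' : Set ℂ := {z | ∀ t : ℝ, 0 ≤ t → z - t • d ∈ T → z - t • d ∈ W} with hW'
  have hW'o : IsOpen W' := by
    have hray : IsClosed ((fun t : ℝ => t • d) '' Set.Ici 0) :=
      (isClosedEmbedding_smul_left hd0).isClosedMap _ isClosed_Ici
    have : W'ᶜ = (T \ W) + ((fun t : ℝ => t • d) '' Set.Ici 0) := by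
      ext z
      simp only [hW', Set.mem_compl_iff, Set.mem_ofPred_eq, Set.mem_add]
      push Not
      constructor
      · rintro ⟨t, ht, h1, h2⟩
        exact ⟨z - t • d, ⟨h1, h2⟩, t • d, ⟨t, ht, rfl⟩, by simp⟩
      · rintro ⟨w, ⟨h1, h2⟩, _, ⟨t, ht, rfl⟩, rfl⟩
        exact ⟨t, ht, by simpa using h1, by simpa using h2⟩
    rw [← isClosed_compl_iff, this]
    exact hray.add_left_of_isCompact (hT.diff hW)
  have hM : IsCompact ((X ∩ T) \ W') := (hX.inter hT).diff hW'o
  have hMS : (X ∩ T) \ W' ⊆ S' := by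
    rintro z ⟨⟨hzX, hzT⟩, hzW⟩
    refine ⟨?_, hXU hzX⟩
    by_contra hzS
    exact hzW fun t ht h => hXW ⟨hshadow z hzX hzT t ht h, hexit z hzX hzT hzS t ht⟩
  obtain ⟨μ, hμ, hμM⟩ : ∃ μ : ℝ, 0 < μ ∧ ∀ z ∈ (X ∩ T) \ W', μ ≤ ρ z :=
    hM.exists_forall_le' (continuous_infDist_pt _).continuousOn fun z hz =>
      (hS'o.isClosed_compl.notMem_iff_infDist_pos hne).1 (by simpa using hMS hz)
  set ℓ : ℂ → ℝ := fun z => (z * (starRingEnd ℂ) d).re with hℓ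
  have hℓc : Continuous ℓ := by fun_prop
  have hℓF : ∀ z, ℓ (F z) = ℓ z - ρ z / 2 := fun z => by
    have : d * (starRingEnd ℂ) d = 1 := by
      rw [Complex.mul_conj, Complex.normSq_eq_norm_sq, hd]; norm_num
    simp only [hℓ, hF', sub_mul, smul_mul_assoc, this]
    simp
  obtain ⟨B, hB⟩ := hT.exists_bound_of_continuousOn hℓc.continuousOn
  have hiter : ∀ n : ℕ, ∃ G : ℂ ≃ₜ ℂ, (∀ z ∉ S', G z = z) ∧ ∀ z ∈ X, z ∈ S' →
      G z ∈ X ∧ G z ∈ S' ∧ (G z ∈ W' ∨ ℓ (G z) ≤ B - n * (μ / 2)) := by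
    intro n
    induction n with
    | zero =>
      refine ⟨Homeomorph.refl ℂ, fun _ _ => rfl, fun z hz hzS => ⟨hz, hzS, Or.inr ?_⟩⟩
      simpa using (le_abs_self _).trans (hB z (hST hzS.1))
    | succ n ih =>
      obtain ⟨G, hG, hGX⟩ := ih
      refine ⟨G.trans F, fun z hz => by simp [hG z hz, hfix z hz], fun z hz hzS => ?_⟩
      obtain ⟨h1, h2, h3⟩ := hGX z hz hzS
      have hT' := hST (hFS _ h2).1
      have hnn : 0 ≤ ρ (G z) / 2 := by have := hρ0 (G z); linarith
      refine ⟨?_, hFS _ h2, ?_⟩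
      · rw [hF'] at hT'
        simp only [Homeomorph.trans_apply, hF']
        exact hshadow _ h1 (hST h2.1) _ hnn hT'
      · by_cases hw : G z ∈ W'
        · left
          intro t ht
          simp only [Homeomorph.trans_apply, hF']
          rw [sub_sub, ← add_smul]
          exact hw _ (by positivity)
        · right
          have h3 := h3.resolve_left hw
          have := hμM (G z) ⟨⟨h1, hST h2.1⟩, hw⟩
          simp only [Homeomorph.trans_apply, hℓF]
          push_cast
          linarith
  obtain ⟨n, hn⟩ := exists_nat_gt (2 * B / (μ / 2))
  obtain ⟨G, hG, hGX⟩ := hiter n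
  refine ⟨G, fun z hz => hG z fun h => hz h.2, fun z hz => ?_⟩
  by_cases hzS : z ∈ S'
  · obtain ⟨h1, h2, h3⟩ := hGX z hz hzS
    have hTG := hST h2.1
    have : G z ∈ W' := by
      refine h3.resolve_right fun h => ?_
      rw [div_lt_iff₀ (by positivity)] at hn
      have := (abs_le.1 (hB _ hTG)).1
      linarith
    simpa using this 0 le_rfl (by simpa using hTG)
  · rw [hG z hzS]
    exact hXW ⟨hz, fun h => hzS ⟨h, hXU hz⟩⟩

/-- The closed cell of the square grid of mesh `2` with centre `m`: a square, an edge or a vertex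
according to the number of odd coordinates of `m`. -/
def gridCell (m : ℤ × ℤ) : Set ℂ :=
  {z | |z.re - m.1| ≤ ((m.1 % 2 : ℤ) : ℝ) ∧ |z.im - m.2| ≤ ((m.2 % 2 : ℤ) : ℝ)}

/-- The union of the cells of a set of grid cells. -/
def gridUnion (K : Finset (ℤ × ℤ)) : Set ℂ := ⋃ m ∈ K, gridCell m

/-- A set of grid cells closed under passing to faces. -/
def IsGridComplex (K : Finset (ℤ × ℤ)) : Prop :=
  ∀ m ∈ K, (Odd m.1 → (m.1 + 1, m.2) ∈ K ∧ (m.1 - 1, m.2) ∈ K) ∧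
    (Odd m.2 → (m.1, m.2 + 1) ∈ K ∧ (m.1, m.2 - 1) ∈ K)

lemma mem_gridUnion {K : Finset (ℤ × ℤ)} {z : ℂ} :
    z ∈ gridUnion K ↔ ∃ m ∈ K, z ∈ gridCell m := by
  simp only [gridUnion, Set.mem_iUnion, exists_prop]

lemma gridUnion_mono {K L : Finset (ℤ × ℤ)} (h : K ⊆ L) : gridUnion K ⊆ gridUnion L :=
  fun z hz => by
    obtain ⟨m, hm, hz⟩ := mem_gridUnion.1 hz
    exact mem_gridUnion.2 ⟨m, h hm, hz⟩

lemma abs_sub_le_emod_two_iff (x : ℝ) (n : ℤ) :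
    |x - n| ≤ ((n % 2 : ℤ) : ℝ) ↔
      (Even n ∧ x = n) ∨ (Odd n ∧ (n : ℝ) - 1 ≤ x ∧ x ≤ n + 1) := by
  rcases Int.even_or_odd n with h | h
  · have : ¬ Odd n := by simpa using h
    simp [Int.even_iff.1 h, h, this, sub_eq_zero]
  · have : ¬ Even n := by simpa using h
    simp only [Int.odd_iff.1 h, h, this, abs_le]
    constructor
    · rintro ⟨h1, h2⟩
      push_cast at h1 h2
      exact Or.inr ⟨trivial, by linarith, by linarith⟩
    · rintro (⟨h1, h2⟩ | ⟨_, h1, h2⟩)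
      · exact h1.elim
      · push_cast
        constructor <;> linarith

lemma mem_gridCell_iff {z : ℂ} {m : ℤ × ℤ} : z ∈ gridCell m ↔
    ((Even m.1 ∧ z.re = m.1) ∨ (Odd m.1 ∧ (m.1 : ℝ) - 1 ≤ z.re ∧ z.re ≤ m.1 + 1)) ∧
    ((Even m.2 ∧ z.im = m.2) ∨ (Odd m.2 ∧ (m.2 : ℝ) - 1 ≤ z.im ∧ z.im ≤ m.2 + 1)) := by
  rw [← abs_sub_le_emod_two_iff, ← abs_sub_le_emod_two_iff]
  rfl

lemma isCompact_reProdIm_Icc (a b c d : ℝ) :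
    IsCompact {z : ℂ | a ≤ z.re ∧ z.re ≤ b ∧ c ≤ z.im ∧ z.im ≤ d} := by
  have := (isCompact_Icc (a := a) (b := b)).reProdIm (isCompact_Icc (a := c) (b := d))
  convert this using 1
  ext z
  simp [Complex.mem_reProdIm, and_assoc]

lemma isCompact_gridCell (m : ℤ × ℤ) : IsCompact (gridCell m) := by
  convert isCompact_reProdIm_Icc (m.1 - (m.1 % 2 : ℤ)) (m.1 + (m.1 % 2 : ℤ))
    (m.2 - (m.2 % 2 : ℤ)) (m.2 + (m.2 % 2 : ℤ)) using 1
  ext z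
  simp only [gridCell, abs_le, Set.mem_ofPred_eq]
  constructor
  · rintro ⟨⟨h1, h2⟩, h3, h4⟩
    refine ⟨?_, ?_, ?_, ?_⟩ <;> linarith
  · rintro ⟨h1, h2, h3, h4⟩
    refine ⟨⟨?_, ?_⟩, ?_, ?_⟩ <;> linarith

lemma isCompact_gridUnion (K : Finset (ℤ × ℤ)) : IsCompact (gridUnion K) :=
  K.isCompact_biUnion fun m _ => isCompact_gridCell m

lemma shrinksIn_gridUnion_of_free_top {K : Finset (ℤ × ℤ)} {U : Set ℂ} (hK : IsGridComplex K)
    (hU : IsOpen U) (hKU : gridUnion K ⊆ U) {a b : ℤ} (ha : Odd a) (hb : Odd b)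
    (hab : (a, b) ∈ K) (htop : (a, b + 2) ∉ K) :
    ShrinksIn U (gridUnion K) (gridUnion (K \ {(a, b), (a, b + 1)})) := by
  set S : Set ℂ := {z | |z.re - a| < 1 ∧ b - 1 < z.im ∧ z.im < b + 1 + (1 - |z.re - a|) / 2}
  set T : Set ℂ := {z | |z.re - a| ≤ 1 ∧ b - 1 ≤ z.im ∧ z.im ≤ b + 1 + (1 - |z.re - a|) / 2}
  have hSo : IsOpen S := by
    refine IsOpen.and ?_ (IsOpen.and ?_ ?_) <;> exact isOpen_lt (by fun_prop) (by fun_prop)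
  have hTc : IsCompact T := by
    refine (isCompact_reProdIm_Icc (a - 1) (a + 1) (b - 1) (b + 2)).of_isClosed_subset ?_ ?_
    · refine IsClosed.and ?_ (IsClosed.and ?_ ?_) <;>
        exact isClosed_le (by fun_prop) (by fun_prop)
    · rintro z ⟨h1, h2, h3⟩
      have := abs_nonneg (z.re - a)
      rw [abs_le] at h1
      refine ⟨?_, ?_, ?_, ?_⟩ <;> linarith
  have hle : ∀ z ∈ gridUnion K, z ∈ T → z.im ≤ b + 1 := by
    rintro z hz ⟨h1, h2, h3⟩
    by_contra! h
    obtain ⟨⟨m, n⟩, hm, hz⟩ := mem_gridUnion.1 hz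
    have hx : |z.re - a| < 1 := by linarith
    have := abs_nonneg (z.re - a)
    rw [abs_lt] at hx
    obtain ⟨hx', hy'⟩ := mem_gridCell_iff.1 hz
    simp only at hx' hy'
    have hm' : m = a := by
      rcases hx' with ⟨he, hx'⟩ | ⟨ho, h4, h5⟩
      · have h6 : m < a + 1 := by exact_mod_cast (by linarith : (m : ℝ) < a + 1)
        have h7 : a - 1 < m := by exact_mod_cast (by linarith : (a : ℝ) - 1 < m)
        lia
      · have h6 : m < a + 2 := by exact_mod_cast (by linarith : (m : ℝ) < a + 2)
        have h7 : a - 2 < m := by exact_mod_cast (by linarith : (a : ℝ) - 2 < m)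
        grind
    have hn' : n = b + 2 := by
      rcases hy' with ⟨he, hy'⟩ | ⟨ho, h4, h5⟩
      · have h6 : n < b + 2 := by exact_mod_cast (by linarith : (n : ℝ) < b + 2)
        have h7 : b + 1 < n := by exact_mod_cast (by linarith : (b : ℝ) + 1 < n)
        lia
      · have h6 : n < b + 3 := by exact_mod_cast (by linarith : (n : ℝ) < b + 3)
        have h7 : b < n := by exact_mod_cast (by linarith : (b : ℝ) < n)
        grind
    exact htop (hn' ▸ hm' ▸ hm)
  refine (shrinksIn_diff_of_shadow (S := S) (T := T) (d := Complex.I) (by simp) hSo hTc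
    (fun z hz => ⟨hz.1.le, hz.2.1.le, hz.2.2.le⟩) hU (isCompact_gridUnion K) hKU
    ?_ ?_).mono ?_
  · intro z hz hzT t ht hT
    have h1 := hle z hz hzT
    refine mem_gridUnion.2 ⟨_, hab, mem_gridCell_iff.2 ⟨Or.inr ⟨ha, ?_⟩, Or.inr ⟨hb, ?_⟩⟩⟩
    · have := abs_le.1 hT.1
      constructor <;> linarith
    · have := hT.2.1
      simp at this ⊢
      constructor <;> linarith
  · rintro z hz hzT hzS t ht ⟨h1, h2, h3⟩
    have h0 := hle z hz hzT
    simp at h1 h2 h3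
    exact hzS ⟨h1, by linarith, by linarith⟩
  · rintro z ⟨hz, hzS⟩
    obtain ⟨m, hm, hz⟩ := mem_gridUnion.1 hz
    by_cases hm' : m ∈ K \ {(a, b), (a, b + 1)}
    · exact mem_gridUnion.2 ⟨m, hm', hz⟩
    have hbox : (a : ℝ) - 1 ≤ z.re ∧ z.re ≤ a + 1 ∧ (b : ℝ) - 1 ≤ z.im ∧ z.im ≤ b + 1 := by
      simp only [Finset.mem_sdiff, hm, true_and, not_not, Finset.mem_insert,
        Finset.mem_singleton] at hm'
      rw [mem_gridCell_iff] at hz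
      rcases hm' with rfl | rfl
      · obtain ⟨hx, hy⟩ := hz
        rcases hx with hx | hx
        · grind
        rcases hy with hy | hy
        · grind
        exact ⟨hx.2.1, hx.2.2, hy.2.1, hy.2.2⟩
      · obtain ⟨hx, hy⟩ := hz
        rcases hx with hx | hx
        · grind
        rcases hy with hy | hy
        · have := hy.2
          push_cast at this
          exact ⟨hx.2.1, hx.2.2, by linarith, by linarith⟩
        · grind
    obtain ⟨h1, h2, h3, h4⟩ := hbox
    have hf := hK _ hab
    have hside : z.re = a - 1 ∨ z.re = a + 1 ∨ z.im = b - 1 := by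
      by_contra! h
      have h5 : |z.re - a| < 1 := by
        rw [abs_lt]
        constructor
        · linarith [lt_of_le_of_ne h1 h.1.symm]
        · linarith [lt_of_le_of_ne h2 h.2.1]
      exact hzS ⟨h5, lt_of_le_of_ne h3 h.2.2.symm, by linarith⟩
    have hne : ∀ n : ℤ × ℤ, n ∈ K → (n.1 ≠ a ∨ n.2 < b) → n ∈ K \ {(a, b), (a, b + 1)} := by
      rintro ⟨n, n'⟩ hn h
      simp only [Finset.mem_sdiff, hn, true_and, Finset.mem_insert, Finset.mem_singleton,
        Prod.mk.injEq]
      simp only at h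
      lia
    rcases hside with h | h | h
    · refine mem_gridUnion.2 ⟨_, hne _ (hf.1 ha).2 (Or.inl (by simp)), mem_gridCell_iff.2
        ⟨Or.inl ⟨ha.sub_odd odd_one, by simpa using h⟩, Or.inr ⟨hb, h3, h4⟩⟩⟩
    · refine mem_gridUnion.2 ⟨_, hne _ (hf.1 ha).1 (Or.inl (by simp)), mem_gridCell_iff.2
        ⟨Or.inl ⟨ha.add_odd odd_one, by simpa using h⟩, Or.inr ⟨hb, h3, h4⟩⟩⟩
    · refine mem_gridUnion.2 ⟨_, hne _ (hf.2 hb).2 (Or.inr (by simp)), mem_gridCell_iff.2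
        ⟨Or.inr ⟨ha, h1, h2⟩, Or.inl ⟨hb.sub_odd odd_one, by simpa using h⟩⟩⟩

/-- A straight whisker of `X` with base point `u`, pointing in the direction `conj c`, can be
retracted. -/
lemma shrinksIn_diff_whisker {U X : Set ℂ} (u : ℂ) {c : ℂ} (hc : ‖c‖ = 1) (hU : IsOpen U)
    (hX : IsCompact X) (hXU : X ⊆ U)
    (hseg : ∀ z, ((z - u) * c).im = 0 → 0 ≤ ((z - u) * c).re → ((z - u) * c).re ≤ 2 → z ∈ X)
    (hwhisk : ∀ z ∈ X, 0 ≤ ((z - u) * c).re → ((z - u) * c).re ≤ 3 →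
      |((z - u) * c).im| ≤ ((z - u) * c).re → |((z - u) * c).im| ≤ 1 →
      ((z - u) * c).im = 0 ∧ ((z - u) * c).re ≤ 2) :
    ShrinksIn U X (X \ {z | ((z - u) * c).im = 0 ∧ 0 < ((z - u) * c).re ∧
      ((z - u) * c).re ≤ 2}) := by
  have hc' : (starRingEnd ℂ) c * c = 1 := by
    rw [mul_comm, Complex.mul_conj, Complex.normSq_eq_norm_sq, hc]; norm_num
  have hshift : ∀ (z : ℂ) (t : ℝ), (z - t • (starRingEnd ℂ) c - u) * c = (z - u) * c - t := by
    intro z t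
    have : (z - t • (starRingEnd ℂ) c - u) * c = (z - u) * c - t * ((starRingEnd ℂ) c * c) := by
      rw [Complex.real_smul]; ring
    rw [this, hc', mul_one]
  set S : Set ℂ := {z | 0 < ((z - u) * c).re ∧ ((z - u) * c).re < 3 ∧
    |((z - u) * c).im| < ((z - u) * c).re ∧ |((z - u) * c).im| < 1}
  set T : Set ℂ := {z | 0 ≤ ((z - u) * c).re ∧ ((z - u) * c).re ≤ 3 ∧
    |((z - u) * c).im| ≤ ((z - u) * c).re ∧ |((z - u) * c).im| ≤ 1}
  have hSo : IsOpen S := by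
    refine IsOpen.and ?_ (IsOpen.and ?_ (IsOpen.and ?_ ?_)) <;>
      exact isOpen_lt (by fun_prop) (by fun_prop)
  have hTc : IsCompact T := by
    refine (isCompact_closedBall u 4).of_isClosed_subset ?_ ?_
    · refine IsClosed.and ?_ (IsClosed.and ?_ (IsClosed.and ?_ ?_)) <;>
        exact isClosed_le (by fun_prop) (by fun_prop)
    · rintro z ⟨h1, h2, h3, h4⟩
      rw [mem_closedBall, dist_eq_norm]
      have := Complex.norm_le_abs_re_add_abs_im ((z - u) * c)
      rw [norm_mul, hc, mul_one, abs_of_nonneg h1] at this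
      linarith
  refine (shrinksIn_diff_of_shadow (S := S) (T := T) (d := (starRingEnd ℂ) c) (by simpa using hc)
    hSo hTc (fun z hz => ⟨hz.1.le, hz.2.1.le, hz.2.2.1.le, hz.2.2.2.le⟩) hU hX hXU ?_ ?_).mono ?_
  · rintro z hz ⟨h1, h2, h3, h4⟩ t ht ⟨h5, -⟩
    obtain ⟨h6, h7⟩ := hwhisk z hz h1 h2 h3 h4
    refine hseg _ ?_ h5 ?_ <;> rw [hshift]
    · simpa using h6
    · rw [Complex.sub_re, Complex.ofReal_re]
      linarith
  · rintro z hz ⟨h1, h2, h3, h4⟩ hzS t ht ⟨h5, -⟩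
    obtain ⟨h6, h7⟩ := hwhisk z hz h1 h2 h3 h4
    rw [hshift] at h5
    simp only [Complex.sub_re, Complex.ofReal_re] at h5
    have : 0 < ((z - u) * c).re := by linarith
    exact hzS ⟨this, by linarith, by rwa [h6, abs_zero], by rw [h6, abs_zero]; exact one_pos⟩
  · rintro z ⟨hz, hzS⟩
    refine ⟨hz, ?_⟩
    rintro ⟨h6, h7, h8⟩
    exact hzS ⟨h7, by linarith, by rwa [h6, abs_zero], by rw [h6, abs_zero]; exact one_pos⟩

/-- The four unit steps from a vertex of the grid to the adjacent edges. -/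
def gridDirs : Finset (ℤ × ℤ) := {(1, 0), (-1, 0), (0, 1), (0, -1)}

lemma abs_neg_sub_le_emod_two {x : ℝ} {n : ℤ} (h : |x - n| ≤ ((n % 2 : ℤ) : ℝ)) :
    |-x - (-n : ℤ)| ≤ (((-n) % 2 : ℤ) : ℝ) := by
  rw [show (-n) % 2 = n % 2 by lia, abs_sub_comm]
  convert h using 2
  push_cast
  ring

lemma abs_sub_sub_le_emod_two {x : ℝ} {n p : ℤ} (hp : Even p) (h : |x - n| ≤ ((n % 2 : ℤ) : ℝ)) :
    |(x - p) - (n - p : ℤ)| ≤ (((n - p) % 2 : ℤ) : ℝ) := by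
  rw [show (n - p) % 2 = n % 2 by grind]
  convert h using 2
  push_cast
  ring

lemma eq_zero_and_le_two_of_grid {x y : ℝ} {k l : ℤ} (hx : |x - k| ≤ ((k % 2 : ℤ) : ℝ))
    (hy : |y - l| ≤ ((l % 2 : ℤ) : ℝ)) (hkl : Even k ∨ Even l) (hx0 : 0 ≤ x) (hx3 : x ≤ 3)
    (hyx : |y| ≤ x) (hy1 : |y| ≤ 1) (h₁ : ¬ (k = 3 ∧ l = 0)) (h₂ : ¬ (k = 2 ∧ l = 1))
    (h₃ : ¬ (k = 2 ∧ l = -1)) : y = 0 ∧ x ≤ 2 := by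
  rw [abs_sub_le_emod_two_iff] at hx hy
  rw [abs_le] at hyx hy1
  rcases hx with ⟨hk, rfl⟩ | ⟨hk, hx1, hx2⟩
  · have h4 : 0 ≤ k := by exact_mod_cast hx0
    have h5 : k ≤ 3 := by exact_mod_cast hx3
    have h6 : k = 0 ∨ k = 2 := by grind
    rcases h6 with rfl | rfl
    · norm_num at hyx ⊢
      linarith
    · refine ⟨?_, by norm_num⟩
      rcases hy with ⟨hl, rfl⟩ | ⟨hl, h7, h8⟩
      · have h9 : -1 ≤ l := by exact_mod_cast hy1.1
        have h10 : l ≤ 1 := by exact_mod_cast hy1.2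
        have : l = 0 := by grind
        simp [this]
      · have h9 : -2 ≤ l := by exact_mod_cast (by linarith [hy1.1] : (-2 : ℝ) ≤ l)
        have h10 : l ≤ 2 := by exact_mod_cast (by linarith [hy1.2] : (l : ℝ) ≤ 2)
        exfalso
        grind
  · have hl : Even l := hkl.resolve_left (by simpa using hk)
    rcases hy with ⟨-, rfl⟩ | ⟨hl', -⟩
    · have h9 : -1 ≤ l := by exact_mod_cast hy1.1
      have h10 : l ≤ 1 := by exact_mod_cast hy1.2
      have hl0 : l = 0 := by grind
      have h11 : -1 ≤ k := by exact_mod_cast (by linarith : (-1 : ℝ) ≤ k)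
      have h12 : k ≤ 4 := by exact_mod_cast (by linarith : (k : ℝ) ≤ 4)
      have h13 : k ≤ 1 := by grind
      have h14 : (k : ℝ) ≤ 1 := by exact_mod_cast h13
      exact ⟨by simp [hl0], by linarith⟩
    · exact absurd hl (by simpa using hl')

lemma shrinksIn_gridUnion_of_leaf {K : Finset (ℤ × ℤ)} {U : Set ℂ} (hK : IsGridComplex K)
    (hU : IsOpen U) (hKU : gridUnion K ⊆ U) (hK2 : ∀ m ∈ K, Even m.1 ∨ Even m.2)
    {v e : ℤ × ℤ} (hv : Even v.1 ∧ Even v.2) (he : e ∈ gridDirs) (hve : v + e ∈ K)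
    (hleaf : ∀ f ∈ gridDirs, v + f ∈ K → f = e) :
    ShrinksIn U (gridUnion K) (gridUnion (K \ {v, v + e})) := by
  obtain ⟨p, q⟩ := v
  obtain ⟨hp, hq⟩ := hv
  simp only at hp hq
  set u : ℂ := ⟨p + 2 * e.1, q + 2 * e.2⟩ with hu
  set c : ℂ := ⟨-e.1, e.2⟩ with hc
  have hre : ∀ z : ℂ, ((z - u) * c).re =
      -(z.re - (p + 2 * e.1)) * e.1 - (z.im - (q + 2 * e.2)) * e.2 := fun z => by
    simp [hu, hc]; ring
  have him : ∀ z : ℂ, ((z - u) * c).im =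
      (z.re - (p + 2 * e.1)) * e.2 - (z.im - (q + 2 * e.2)) * e.1 := fun z => by
    simp [hu, hc]; ring
  have hc1 : ‖c‖ = 1 := by
    have : ‖c‖ ^ 2 = 1 := by
      rw [← Complex.normSq_eq_norm_sq, Complex.normSq_apply]
      simp only [gridDirs, Finset.mem_insert, Finset.mem_singleton] at he
      rcases he with rfl | rfl | rfl | rfl <;> simp [hc]
    exact (pow_eq_one_iff_of_nonneg (norm_nonneg c) two_ne_zero).1 this
  have hedge : ∀ z : ℂ, z ∈ gridCell ((p, q) + e) ↔
      ((z - u) * c).im = 0 ∧ 0 ≤ ((z - u) * c).re ∧ ((z - u) * c).re ≤ 2 := by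
    intro z
    rw [mem_gridCell_iff, hre, him]
    have hp' : ¬ Odd p := by simpa using hp
    have hq' : ¬ Odd q := by simpa using hq
    have hp1 : Odd (p + 1) := hp.add_one
    have hq1 : Odd (q + 1) := hq.add_one
    have hp2 : Odd (p + -1) := hp.add_odd (by decide)
    have hq2 : Odd (q + -1) := hq.add_odd (by decide)
    have hp1' : ¬ Even (p + 1) := by simpa using hp1
    have hq1' : ¬ Even (q + 1) := by simpa using hq1
    have hp2' : ¬ Even (p + -1) := by simpa using hp2
    have hq2' : ¬ Even (q + -1) := by simpa using hq2
    simp only [gridDirs, Finset.mem_insert, Finset.mem_singleton] at he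
    rcases he with rfl | rfl | rfl | rfl <;>
      simp only [Prod.mk_add_mk, add_zero, hp, hq, hp', hq', hp1, hp1', hq1, hq1', hp2, hp2',
        hq2, hq2', true_and, false_and, or_false, false_or] <;> push_cast <;>
      constructor
    all_goals
      intro h
      obtain ⟨h1, h2⟩ := h
      first
        | obtain ⟨h2, h3⟩ := h2
        | obtain ⟨h1, h3⟩ := h1
      refine ⟨?_, ?_⟩
      all_goals first
        | constructor <;> linarith
        | linarith
  have huK : (p, q) + e + e ∈ K := by
    have := hK _ hve
    simp only [gridDirs, Finset.mem_insert, Finset.mem_singleton] at he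
    rcases he with rfl | rfl | rfl | rfl
    · simpa using (this.1 (hp.add_odd (by decide))).1
    · simpa [sub_eq_add_neg] using (this.1 (hp.add_odd (by decide))).2
    · simpa using (this.2 (hq.add_odd (by decide))).1
    · simpa [sub_eq_add_neg] using (this.2 (hq.add_odd (by decide))).2
  have he0 : e ≠ 0 ∧ e + e ≠ 0 := by
    simp only [gridDirs, Finset.mem_insert, Finset.mem_singleton] at he
    rcases he with rfl | rfl | rfl | rfl <;> simp
  refine (shrinksIn_diff_whisker u hc1 hU (isCompact_gridUnion K) hKU
    (fun z h1 h2 h3 => mem_gridUnion.2 ⟨_, hve, (hedge z).2 ⟨h1, h2, h3⟩⟩) ?_).mono ?_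
  · intro z hz h0 h3 hi hi1
    obtain ⟨⟨m, n⟩, hm, hx, hy⟩ := mem_gridUnion.1 hz
    have hpar := hK2 _ hm
    rw [hre] at h0 h3 hi ⊢
    rw [him] at hi hi1 ⊢
    simp only [gridDirs, Finset.mem_insert, Finset.mem_singleton] at he hleaf
    have hf : ∀ f : ℤ × ℤ, (f = (1, 0) ∨ f = (-1, 0) ∨ f = (0, 1) ∨ f = (0, -1)) → f ≠ e →
      (m, n) ≠ (p, q) + f := fun f hf hne h => hne (hleaf f hf (h ▸ hm))
    simp only at hx hy hpar
    rcases he with rfl | rfl | rfl | rfl <;> push_cast at h0 h3 hi hi1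
    · have := eq_zero_and_le_two_of_grid
        (abs_neg_sub_le_emod_two (abs_sub_sub_le_emod_two (p := p + 2) (hp.add (by decide)) hx))
        (abs_neg_sub_le_emod_two (abs_sub_sub_le_emod_two hq hy))
        (by grind) (by push_cast; linarith) (by push_cast; linarith)
        ((congrArg abs (by ring)).trans_le (hi.trans_eq (by push_cast; ring)))
        ((congrArg abs (by ring)).trans_le hi1)
        (fun h => hf (-1, 0) (by simp) (by simp) (Prod.ext (by simp; lia) (by simp; lia)))
        (fun h => hf (0, -1) (by simp) (by simp) (Prod.ext (by simp; lia) (by simp; lia)))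
        (fun h => hf (0, 1) (by simp) (by simp) (Prod.ext (by simp; lia) (by simp; lia)))
      push_cast at this ⊢
      constructor <;> linarith [this.1, this.2]
    · have := eq_zero_and_le_two_of_grid
        (abs_sub_sub_le_emod_two (p := p - 2) (hp.sub (by decide)) hx)
        (abs_sub_sub_le_emod_two hq hy)
        (by grind) (by push_cast; linarith) (by push_cast; linarith)
        ((congrArg abs (by ring)).trans_le (hi.trans_eq (by push_cast; ring)))
        ((congrArg abs (by ring)).trans_le hi1)
        (fun h => hf (1, 0) (by simp) (by simp) (Prod.ext (by simp; lia) (by simp; lia)))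
        (fun h => hf (0, 1) (by simp) (by simp) (Prod.ext (by simp; lia) (by simp; lia)))
        (fun h => hf (0, -1) (by simp) (by simp) (Prod.ext (by simp; lia) (by simp; lia)))
      push_cast at this ⊢
      constructor <;> linarith [this.1, this.2]
    · have := eq_zero_and_le_two_of_grid
        (abs_neg_sub_le_emod_two (abs_sub_sub_le_emod_two (p := q + 2) (hq.add (by decide)) hy))
        (abs_sub_sub_le_emod_two hp hx)
        (by grind) (by push_cast; linarith) (by push_cast; linarith)
        ((congrArg abs (by ring)).trans_le (hi.trans_eq (by push_cast; ring)))
        ((congrArg abs (by ring)).trans_le hi1)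
        (fun h => hf (0, -1) (by simp) (by simp) (Prod.ext (by simp; lia) (by simp; lia)))
        (fun h => hf (1, 0) (by simp) (by simp) (Prod.ext (by simp; lia) (by simp; lia)))
        (fun h => hf (-1, 0) (by simp) (by simp) (Prod.ext (by simp; lia) (by simp; lia)))
      push_cast at this ⊢
      constructor <;> linarith [this.1, this.2]
    · have := eq_zero_and_le_two_of_grid
        (abs_sub_sub_le_emod_two (p := q - 2) (hq.sub (by decide)) hy)
        (abs_neg_sub_le_emod_two (abs_sub_sub_le_emod_two hp hx))
        (by grind) (by push_cast; linarith) (by push_cast; linarith)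
        ((congrArg abs (by ring)).trans_le (hi.trans_eq (by push_cast; ring)))
        ((congrArg abs (by ring)).trans_le hi1)
        (fun h => hf (0, 1) (by simp) (by simp) (Prod.ext (by simp; lia) (by simp; lia)))
        (fun h => hf (-1, 0) (by simp) (by simp) (Prod.ext (by simp; lia) (by simp; lia)))
        (fun h => hf (1, 0) (by simp) (by simp) (Prod.ext (by simp; lia) (by simp; lia)))
      push_cast at this ⊢
      constructor <;> linarith [this.1, this.2]
  · rintro z ⟨hz, hzS⟩
    obtain ⟨m, hm, hz⟩ := mem_gridUnion.1 hz
    by_cases hm' : m ∈ K \ {(p, q), (p, q) + e}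
    · exact mem_gridUnion.2 ⟨m, hm', hz⟩
    have hzv : z ∈ gridCell (p, q) → z ∈ gridCell ((p, q) + e) := by
      intro h
      rw [hedge, hre, him]
      rw [mem_gridCell_iff] at h
      have hp' : ¬ Odd p := by simpa using hp
      have hq' : ¬ Odd q := by simpa using hq
      simp only [hp, hq, hp', hq', true_and, false_and, or_false] at h
      simp only [gridDirs, Finset.mem_insert, Finset.mem_singleton] at he
      rcases he with rfl | rfl | rfl | rfl <;> simp [h]
    have hzu : z ∈ gridCell ((p, q) + e) := by
      simp only [Finset.mem_sdiff, hm, true_and, not_not, Finset.mem_insert,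
        Finset.mem_singleton] at hm'
      rcases hm' with rfl | rfl
      · exact hzv hz
      · exact hz
    obtain ⟨h1, h2, h3⟩ := (hedge z).1 hzu
    have h4 : ((z - u) * c).re = 0 := by
      by_contra h
      exact hzS ⟨h1, lt_of_le_of_ne h2 (Ne.symm h), h3⟩
    refine mem_gridUnion.2 ⟨(p, q) + e + e, ?_, ?_⟩
    · simp only [Finset.mem_sdiff, huK, true_and, Finset.mem_insert, Finset.mem_singleton]
      rintro (h | h)
      · exact he0.2 (by simpa [add_assoc] using h)
      · exact he0.1 (by simpa using h)
    · rw [hre] at h4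
      rw [him] at h1
      rw [mem_gridCell_iff]
      have hp1 : Even (p + 1 + 1) := by grind
      have hq1 : Even (q + 1 + 1) := by grind
      have hp2 : Even (p + -1 + -1) := by grind
      have hq2 : Even (q + -1 + -1) := by grind
      simp only [gridDirs, Finset.mem_insert, Finset.mem_singleton] at he
      rcases he with rfl | rfl | rfl | rfl <;> push_cast at h1 h4 <;>
        refine ⟨Or.inl ⟨by simpa, ?_⟩, Or.inl ⟨by simpa, ?_⟩⟩ <;>
        simp <;> linarith

/-- The complement of the grid complex `K` is connected: a two-colouring of the squares which only
changes across edges of `K` is constant on the squares outside `K`. -/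
def IsNonseparatingGrid (K : Finset (ℤ × ℤ)) : Prop :=
  ∀ c : ℤ × ℤ → ZMod 2,
    (∀ a b, Odd a → Even b → (a, b) ∉ K → c (a, b + 1) = c (a, b - 1)) →
    (∀ a b, Even a → Odd b → (a, b) ∉ K → c (a + 1, b) = c (a - 1, b)) →
    ∀ m n : ℤ × ℤ, Odd m.1 → Odd m.2 → Odd n.1 → Odd n.2 → m ∉ K → n ∉ K → c m = c n

lemma exists_primitive_of_bounded_below {f : ℤ → ZMod 2} {N : ℤ} (hf : ∀ n < N, f n = 0) :
    ∃ F : ℤ → ZMod 2, (∀ n, F (n + 1) = F n + f n) ∧ ∀ n ≤ N, F n = 0 := by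
  refine ⟨fun n => ∑ k ∈ Finset.Ico N n, f k, fun n => ?_, fun n hn => by simp [hn]⟩
  rcases lt_or_ge n N with h | h
  · simp only [hf n h, Finset.Ico_eq_empty_of_le h.le,
      Finset.Ico_eq_empty_of_le (Int.add_one_le_of_lt h)]
    simp
  · beta_reduce
    rw [← Finset.insert_Ico_right_eq_Ico_add_one h, Finset.sum_insert (by simp), add_comm]

/-- A cycle modulo `2` of grid edges is the boundary of a set of squares. -/
lemma exists_coloring_of_cycle {X : ℤ × ℤ → ZMod 2} {N : ℤ} (hN : ∀ m : ℤ × ℤ, m.1 < N → X m = 0)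
    (hX : ∀ a b, Even a → Even b →
      X (a + 1, b) + X (a - 1, b) + X (a, b + 1) + X (a, b - 1) = 0) :
    ∃ c : ℤ × ℤ → ZMod 2,
      (∀ a b, Odd a → Even b → c (a, b + 1) + c (a, b - 1) = X (a, b)) ∧
      (∀ a b, Even a → Odd b → c (a + 1, b) + c (a - 1, b) = X (a, b)) := by
  have hprim : ∀ b, ∃ F : ℤ → ZMod 2, (∀ n, F (n + 1) = F n + X (2 * n, b)) ∧
      ∀ n ≤ min N 0, F n = 0 := fun b =>
    exists_primitive_of_bounded_below (f := fun n => X (2 * n, b))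
      (fun n hn => hN _ (by simp only; lia))
  choose F hF hF0 using hprim
  refine ⟨fun m => F m.2 ((m.1 + 1) / 2), ?_, ?_⟩
  · intro a b ha hb
    obtain ⟨n, rfl⟩ : ∃ n, a = 2 * n - 1 := ⟨(a + 1) / 2, by grind⟩
    have key : ∀ n : ℤ, F (b + 1) n + F (b - 1) n + X (2 * n - 1, b) = 0 := by
      intro n
      rcases le_total n (min N 0) with h | h
      · rw [hF0 _ _ h, hF0 _ _ h, hN _ (by simp only; lia)]
        simp
      · induction n, h using Int.leInduction with
        | base =>
          rw [hF0 _ _ le_rfl, hF0 _ _ le_rfl, hN _ (by simp only; lia)]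
          simp
        | succ n _ ih =>
          have h1 := hX (2 * n) b (by simp) hb
          rw [hF, hF, show 2 * (n + 1) - 1 = 2 * n + 1 by ring]
          have h2 : X (2 * n - 1, b) + X (2 * n - 1, b) = 0 := CharTwo.add_self_eq_zero _
          linear_combination ih + h1 - h2
    have h := CharTwo.add_eq_zero.1 (key n)
    simp only
    rw [show (2 * n - 1 + 1) / 2 = n by lia, h]
  · rintro a b ⟨n, rfl⟩ hb
    simp only
    rw [show (n + n + 1 + 1) / 2 = n + 1 by lia, show (n + n - 1 + 1) / 2 = n by lia, hF,
      show n + n = 2 * n by ring]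
    have h2 : F b n + F b n = 0 := CharTwo.add_self_eq_zero _
    linear_combination h2

/-- In a nonempty one-dimensional grid complex without leaves there is a nontrivial cycle
modulo `2`. -/
lemma exists_cycle_of_no_leaf {K : Finset (ℤ × ℤ)} (hK : IsGridComplex K)
    (hK2 : ∀ m ∈ K, Even m.1 ∨ Even m.2) (hedge : ∃ m ∈ K, Odd m.1 ∨ Odd m.2)
    (hleaf : ∀ v : ℤ × ℤ, Even v.1 → Even v.2 → ∀ e ∈ gridDirs, v + e ∈ K →
      ∃ f ∈ gridDirs, v + f ∈ K ∧ f ≠ e) :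
    ∃ X : ℤ × ℤ → ZMod 2, X ≠ 0 ∧ (∀ m, X m ≠ 0 → m ∈ K ∧ (Odd m.1 ∨ Odd m.2)) ∧
      ∀ v : ℤ × ℤ, Even v.1 → Even v.2 → ∑ f ∈ gridDirs, X (v + f) = 0 := by
  classical
  set E := K.filter fun m => Odd m.1 ∨ Odd m.2 with hE
  set V := K.filter fun v => (Even v.1 ∧ Even v.2) ∧ ∃ e ∈ gridDirs, v + e ∈ K with hV
  set P := (V ×ˢ gridDirs).filter fun p => p.1 + p.2 ∈ K with hP
  have hdir : ∀ v e : ℤ × ℤ, Even v.1 → Even v.2 → e ∈ gridDirs → v + e ∈ K →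
      v + e ∈ E ∧ v ∈ V ∧ v + e + e ∈ V ∧ -e ∈ gridDirs ∧ e ≠ -e := by
    rintro ⟨a, b⟩ e ha hb he h
    have h' := hK _ h
    have he' := he
    simp only [gridDirs, Finset.mem_insert, Finset.mem_singleton] at he'
    simp only at ha hb
    have hneg : -e ∈ gridDirs := by
      rcases he' with rfl | rfl | rfl | rfl <;> simp [gridDirs]
    have h1 : (a, b) + e ∈ E := by
      simp only [hE, Finset.mem_filter, h, true_and]
      rcases he' with rfl | rfl | rfl | rfl <;> simp <;> grind
    have h2 : (a, b) ∈ K := by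
      rcases he' with rfl | rfl | rfl | rfl
      · simpa using (h'.1 (ha.add_odd (by decide))).2
      · simpa using (h'.1 (ha.add_odd (by decide))).1
      · simpa using (h'.2 (hb.add_odd (by decide))).2
      · simpa using (h'.2 (hb.add_odd (by decide))).1
    have h3 : (a, b) + e + e ∈ K := by
      rcases he' with rfl | rfl | rfl | rfl
      · simpa using (h'.1 (ha.add_odd (by decide))).1
      · simpa [sub_eq_add_neg] using (h'.1 (ha.add_odd (by decide))).2
      · simpa using (h'.2 (hb.add_odd (by decide))).1
      · simpa [sub_eq_add_neg] using (h'.2 (hb.add_odd (by decide))).2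
    refine ⟨h1, ?_, ?_, hneg, ?_⟩
    · simp only [hV, Finset.mem_filter]
      exact ⟨h2, ⟨ha, hb⟩, e, he, h⟩
    · simp only [hV, Finset.mem_filter]
      refine ⟨h3, ?_, -e, hneg, by simpa using h⟩
      rcases he' with rfl | rfl | rfl | rfl <;> simp <;> grind
    · rcases he' with rfl | rfl | rfl | rfl <;> simp
  have hmemV : ∀ v ∈ V, Even v.1 ∧ Even v.2 := fun v hv => (Finset.mem_filter.1 hv).2.1
  have hVne : V.Nonempty := by
    obtain ⟨⟨a, b⟩, hm, ho⟩ := hedge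
    have h2 := hK2 _ hm
    simp only at ho h2
    rcases ho with ho | ho
    · refine ⟨_, (hdir (a - 1, b) (1, 0) ?_ ?_ (by simp [gridDirs]) (by simpa using hm)).2.1⟩ <;>
        simp only <;> grind
    · refine ⟨_, (hdir (a, b - 1) (0, 1) ?_ ?_ (by simp [gridDirs]) (by simpa using hm)).2.1⟩ <;>
        simp only <;> grind
  have hcard : V.card ≤ E.card := by
    have h1 : 2 * (P.image Prod.fst).card ≤ P.card := by
      refine Finset.mul_card_image_le_card _ _ fun v hv => ?_
      obtain ⟨⟨v', e⟩, hp, rfl⟩ := Finset.mem_image.1 hv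
      simp only [hP, Finset.mem_filter, Finset.mem_product] at hp
      obtain ⟨⟨hv', he⟩, hve⟩ := hp
      obtain ⟨f, hf, hvf, hfe⟩ := hleaf v' (hmemV _ hv').1 (hmemV _ hv').2 e he hve
      refine Finset.one_lt_card.2 ⟨(v', e), ?_, (v', f), ?_, by simpa using hfe.symm⟩ <;>
        simp [hP, hv', he, hf, hve, hvf]
    have h2 : V ⊆ P.image Prod.fst := fun v hv => by
      obtain ⟨-, -, e, he, h⟩ := Finset.mem_filter.1 hv
      exact Finset.mem_image.2 ⟨(v, e), by simp [hP, hv, he, h], rfl⟩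
    have h3 : P.card ≤ 2 * (P.image fun p => p.1 + p.2).card := by
      refine Finset.card_le_mul_card_image _ _ fun m _ => ?_
      rcases Int.even_or_odd m.1 with h | h
      · refine (Finset.card_le_card (t := {(m - (0, 1), (0, 1)), (m - (0, -1), (0, -1))})
          ?_).trans Finset.card_le_two
        rintro ⟨v, e⟩ hp
        simp only [hP, Finset.mem_filter, Finset.mem_product] at hp
        obtain ⟨⟨⟨hv, he⟩, -⟩, rfl⟩ := hp
        have := hmemV v hv
        simp only [gridDirs, Finset.mem_insert, Finset.mem_singleton] at he
        rcases he with rfl | rfl | rfl | rfl <;> simp at h ⊢ <;> grind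
      · refine (Finset.card_le_card (t := {(m - (1, 0), (1, 0)), (m - (-1, 0), (-1, 0))})
          ?_).trans Finset.card_le_two
        rintro ⟨v, e⟩ hp
        simp only [hP, Finset.mem_filter, Finset.mem_product] at hp
        obtain ⟨⟨⟨hv, he⟩, -⟩, rfl⟩ := hp
        have := hmemV v hv
        simp only [gridDirs, Finset.mem_insert, Finset.mem_singleton] at he
        rcases he with rfl | rfl | rfl | rfl <;> simp at h ⊢ <;> grind
    have h4 : (P.image fun p => p.1 + p.2) ⊆ E := fun m hm => by
      obtain ⟨⟨v, e⟩, hp, rfl⟩ := Finset.mem_image.1 hm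
      simp only [hP, Finset.mem_filter, Finset.mem_product] at hp
      exact (hdir v e (hmemV _ hp.1.1).1 (hmemV _ hp.1.1).2 hp.1.2 hp.2).1
    have := Finset.card_le_card h2
    have := Finset.card_le_card h4
    lia
  obtain ⟨v₀, hv₀⟩ := hVne
  set L : (E → ZMod 2) →ₗ[ZMod 2] (V.erase v₀ → ZMod 2) :=
    LinearMap.pi fun v => ∑ f ∈ gridDirs,
      LinearMap.proj (v.1 + f) ∘ₗ Function.ExtendByZero.linearMap (ZMod 2) Subtype.val with hL
  have hker : LinearMap.ker L ≠ ⊥ := by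
    apply LinearMap.ker_ne_bot_of_finrank_lt
    have := Finset.card_pos.2 ⟨v₀, hv₀⟩
    simp [Finset.card_erase_of_mem hv₀]
    lia
  obtain ⟨x, hx, hx0⟩ := (Submodule.ne_bot_iff _).1 hker
  set X : ℤ × ℤ → ZMod 2 := Function.extend Subtype.val x 0 with hXdef
  have hXx : ∀ e : E, X e = x e := fun e => Subtype.val_injective.extend_apply x 0 e
  have hXE : ∀ m, X m ≠ 0 → m ∈ E := by
    intro m hm
    by_contra h
    refine hm (Function.extend_apply' _ _ _ ?_)
    rintro ⟨e, rfl⟩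
    exact h e.2
  have hXV : ∀ v ∈ V, v ≠ v₀ → ∑ f ∈ gridDirs, X (v + f) = 0 := by
    intro v hv hne
    have := congrFun (LinearMap.mem_ker.1 hx) ⟨v, Finset.mem_erase.2 ⟨hne, hv⟩⟩
    simpa [hL] using this
  have htotal : ∑ v ∈ V, ∑ f ∈ gridDirs, X (v + f) = 0 := by
    rw [← Finset.sum_product', ← Finset.sum_filter_add_sum_filter_not _ fun p => p.1 + p.2 ∈ K]
    have h1 : ∑ p ∈ (V ×ˢ gridDirs).filter (fun p => ¬ p.1 + p.2 ∈ K), X (p.1 + p.2) = 0 := by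
      refine Finset.sum_eq_zero fun p hp => ?_
      by_contra h
      exact (Finset.mem_filter.1 hp).2 (Finset.mem_filter.1 (hXE _ h)).1
    rw [h1, add_zero]
    refine Finset.sum_involution (fun p _ => (p.1 + p.2 + p.2, -p.2)) ?_ ?_ ?_ ?_
    · intro p _
      simpa using CharTwo.add_self_eq_zero (X (p.1 + p.2))
    · intro p hp _ h
      simp only [Finset.mem_filter, Finset.mem_product] at hp
      exact (hdir p.1 p.2 (hmemV _ hp.1.1).1 (hmemV _ hp.1.1).2 hp.1.2 hp.2).2.2.2.2
        (congrArg Prod.snd h).symm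
    · intro p hp
      simp only [Finset.mem_filter, Finset.mem_product] at hp ⊢
      have := hdir p.1 p.2 (hmemV _ hp.1.1).1 (hmemV _ hp.1.1).2 hp.1.2 hp.2
      exact ⟨⟨this.2.2.1, this.2.2.2.1⟩, by simpa using hp.2⟩
    · intro p _
      simp
  refine ⟨X, ?_, fun m hm => by simpa [hE] using hXE m hm, fun v ha hb => ?_⟩
  · intro h
    refine hx0 (funext fun e => ?_)
    rw [← hXx, h]
    rfl
  · by_cases hv : v ∈ V
    · by_cases hne : v = v₀
      · rw [Finset.sum_eq_single_of_mem v hv fun w hw hwv => hXV w hw (hne ▸ hwv)] at htotal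
        exact htotal
      · exact hXV v hv hne
    · refine Finset.sum_eq_zero fun f hf => ?_
      by_contra h
      exact hv (hdir v f ha hb hf (Finset.mem_filter.1 (hXE _ h)).1).2.1

lemma IsNonseparatingGrid.exists_leaf {K : Finset (ℤ × ℤ)} (hsep : IsNonseparatingGrid K)
    (hK : IsGridComplex K) (hK2 : ∀ m ∈ K, Even m.1 ∨ Even m.2)
    (hedge : ∃ m ∈ K, Odd m.1 ∨ Odd m.2) :
    ∃ v : ℤ × ℤ, (Even v.1 ∧ Even v.2) ∧ ∃ e ∈ gridDirs, v + e ∈ K ∧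
      ∀ f ∈ gridDirs, v + f ∈ K → f = e := by
  by_contra! hno
  obtain ⟨X, hX0, hXK, hX⟩ := exists_cycle_of_no_leaf hK hK2 hedge
    fun v ha hb e he hve => hno v ⟨ha, hb⟩ e he hve
  obtain ⟨N, hN⟩ : ∃ N : ℤ, ∀ m ∈ K, N ≤ m.1 := by
    obtain ⟨N, hN⟩ := (K.image Prod.fst).bddBelow
    exact ⟨N, fun m hm => hN (by simpa using ⟨m.2, hm⟩)⟩
  obtain ⟨c, hc1, hc2⟩ := exists_coloring_of_cycle (X := X) (N := N)
    (fun m hm => by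
      by_contra h
      exact absurd (hN m (hXK m h).1) (not_le.2 hm))
    (fun a b ha hb => by
      have := hX (a, b) ha hb
      simp [gridDirs] at this
      simp only [sub_eq_add_neg]
      linear_combination this)
  have hzero : ∀ m, m ∉ K → X m = 0 := fun m hm => by
    by_contra h
    exact hm (hXK m h).1
  have hconst := hsep c
    (fun a b ha hb h => CharTwo.add_eq_zero.1 ((hc1 a b ha hb).trans (hzero _ h)))
    (fun a b ha hb h => CharTwo.add_eq_zero.1 ((hc2 a b ha hb).trans (hzero _ h)))
  have hsq : ∀ m : ℤ × ℤ, Odd m.1 → Odd m.2 → m ∉ K := fun m h1 h2 h =>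
    (hK2 m h).elim (by simpa using h1) (by simpa using h2)
  refine hX0 (funext fun m => ?_)
  by_contra h
  obtain ⟨hmK, hodd⟩ := hXK m h
  have hpar := hK2 m hmK
  apply h
  rcases hodd with ho | ho
  · have he : Even m.2 := hpar.resolve_left (by simpa using ho)
    rw [← hc1 m.1 m.2 ho he]
    exact CharTwo.add_eq_zero.2 (hconst _ _ ho he.add_one ho (he.sub_odd odd_one)
      (hsq _ ho he.add_one) (hsq _ ho (he.sub_odd odd_one)))
  · have he : Even m.1 := hpar.resolve_right (by simpa using ho)
    rw [← hc2 m.1 m.2 he ho]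
    exact CharTwo.add_eq_zero.2 (hconst _ _ he.add_one ho (he.sub_odd odd_one) ho
      (hsq _ he.add_one ho) (hsq _ (he.sub_odd odd_one) ho))

lemma IsGridComplex.sdiff_leaf {K : Finset (ℤ × ℤ)} (hK : IsGridComplex K)
    (hK2 : ∀ m ∈ K, Even m.1 ∨ Even m.2) {v e : ℤ × ℤ} (hv : Even v.1 ∧ Even v.2)
    (he : e ∈ gridDirs) (hleaf : ∀ f ∈ gridDirs, v + f ∈ K → f = e) :
    IsGridComplex (K \ {v, v + e}) := by
  obtain ⟨a, b⟩ := v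
  rintro ⟨x, y⟩ hm
  have hf1 := hleaf (1, 0) (by simp [gridDirs])
  have hf2 := hleaf (-1, 0) (by simp [gridDirs])
  have hf3 := hleaf (0, 1) (by simp [gridDirs])
  have hf4 := hleaf (0, -1) (by simp [gridDirs])
  clear hleaf
  simp only [gridDirs, Finset.mem_insert, Finset.mem_singleton] at he
  rcases he with rfl | rfl | rfl | rfl <;>
  · simp only [Finset.mem_sdiff, Finset.mem_insert, Finset.mem_singleton, not_or, Prod.mk_add_mk,
      Prod.mk.injEq] at *
    obtain ⟨hmK, hmv, hme⟩ := hm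
    have hKm := hK _ hmK
    have hpar := hK2 _ hmK
    clear hK hK2
    refine ⟨fun ho => ⟨⟨(hKm.1 ho).1, ?_, ?_⟩, ⟨(hKm.1 ho).2, ?_, ?_⟩⟩,
      fun ho => ⟨⟨(hKm.2 ho).1, ?_, ?_⟩, ⟨(hKm.2 ho).2, ?_, ?_⟩⟩⟩ <;> grind

lemma IsGridComplex.sdiff_free_top {K : Finset (ℤ × ℤ)} (hK : IsGridComplex K) {a b : ℤ}
    (ha : Odd a) (hb : Odd b) (htop : (a, b + 2) ∉ K) :
    IsGridComplex (K \ {(a, b), (a, b + 1)}) := by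
  rintro ⟨x, y⟩ hm
  simp only [Finset.mem_sdiff, Finset.mem_insert, Finset.mem_singleton, not_or, Prod.mk.injEq]
    at hm ⊢
  obtain ⟨hmK, hmv, hme⟩ := hm
  have hKm := hK _ hmK
  clear hK
  refine ⟨fun ho => ⟨⟨(hKm.1 ho).1, ?_, ?_⟩, ⟨(hKm.1 ho).2, ?_, ?_⟩⟩,
    fun ho => ⟨⟨(hKm.2 ho).1, ?_, ?_⟩, ⟨(hKm.2 ho).2, ?_, ?_⟩⟩⟩ <;> grind

lemma IsNonseparatingGrid.exists_shrinksIn_finite {K : Finset (ℤ × ℤ)}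
    (hsep : IsNonseparatingGrid K) (hK : IsGridComplex K) {U : Set ℂ} (hU : IsOpen U)
    (hKU : gridUnion K ⊆ U) :
    ∃ F : Set ℂ, F.Finite ∧ F ⊆ gridUnion K ∧ ShrinksIn U (gridUnion K) F := by
  induction K using Finset.strongInduction with
  | H K ih =>
  have step : ∀ K' : Finset (ℤ × ℤ), K' ⊂ K → IsNonseparatingGrid K' → IsGridComplex K' →
      ShrinksIn U (gridUnion K) (gridUnion K') →
      ∃ F : Set ℂ, F.Finite ∧ F ⊆ gridUnion K ∧ ShrinksIn U (gridUnion K) F := by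
    intro K' hss hsep' hK' hsh
    have hsub := gridUnion_mono hss.1
    obtain ⟨F, hF, hFK, hsF⟩ := ih K' hss hsep' hK' (hsub.trans hKU)
    exact ⟨F, hF, hFK.trans hsub, hsh.trans hsF⟩
  by_cases hK2 : ∀ m ∈ K, Even m.1 ∨ Even m.2
  · by_cases hedge : ∃ m ∈ K, Odd m.1 ∨ Odd m.2
    · obtain ⟨v, hv, e, he, hve, hleaf⟩ := hsep.exists_leaf hK hK2 hedge
      refine step (K \ {v, v + e}) ?_ ?_ ?_
        (shrinksIn_gridUnion_of_leaf hK hU hKU hK2 hv he hve hleaf)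
      · refine Finset.ssubset_iff_subset_ne.2 ⟨Finset.sdiff_subset, fun h => ?_⟩
        rw [← h] at hve
        simp at hve
      · intro c h1 h2 m n hm hm' hn hn' _ _
        have hsq : ∀ m : ℤ × ℤ, Odd m.1 → Odd m.2 → m ∉ K := fun m h1 h2 h =>
          (hK2 m h).elim (by simpa using h1) (by simpa using h2)
        exact hsep c (fun a b ha hb h => h1 a b ha hb (by simp [h]))
          (fun a b ha hb h => h2 a b ha hb (by simp [h])) m n hm hm' hn hn'
          (hsq m hm hm') (hsq n hn hn')
      · exact hK.sdiff_leaf hK2 hv he hleaf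
    · refine ⟨gridUnion K, ?_, subset_rfl, ShrinksIn.refl U _⟩
      refine K.finite_toSet.biUnion fun m hm => (Set.finite_singleton (⟨m.1, m.2⟩ : ℂ)).subset ?_
      push Not at hedge
      obtain ⟨h1, h2⟩ := hedge m hm
      rintro z ⟨hz1, hz2⟩
      simp only [Int.not_odd_iff_even, Int.even_iff] at h1 h2
      rw [h1, Int.cast_zero, abs_nonpos_iff, sub_eq_zero] at hz1
      rw [h2, Int.cast_zero, abs_nonpos_iff, sub_eq_zero] at hz2
      exact Complex.ext hz1 hz2
  · push Not at hK2
    obtain ⟨m₀, hm₀, ho₀⟩ := hK2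
    obtain ⟨⟨a, b⟩, hm, hmax⟩ := (K.filter fun m => Odd m.1 ∧ Odd m.2).exists_max_image Prod.snd
      ⟨m₀, by simpa [hm₀] using ho₀⟩
    obtain ⟨hab, ha, hb⟩ := Finset.mem_filter.1 hm
    simp only at ha hb hmax
    have htop : (a, b + 2) ∉ K := fun h => by
      have := hmax (a, b + 2) (Finset.mem_filter.2 ⟨h, ha, hb.add_even even_two⟩)
      simp at this
    refine step (K \ {(a, b), (a, b + 1)}) ?_ ?_ ?_
      (shrinksIn_gridUnion_of_free_top hK hU hKU ha hb hab htop)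
    · refine Finset.ssubset_iff_subset_ne.2 ⟨Finset.sdiff_subset, fun h => ?_⟩
      rw [← h] at hab
      simp at hab
    · intro c h1 h2
      have hc : c (a, b + 2) = c (a, b) := by
        have := h1 a (b + 1) ha hb.add_one (by simp)
        rwa [add_assoc, one_add_one_eq_two, add_sub_cancel_right] at this
      suffices key : ∀ m : ℤ × ℤ, Odd m.1 → Odd m.2 → m ∉ K \ {(a, b), (a, b + 1)} →
          c m = c (a, b + 2) from fun m n hm hm' hn hn' hmK hnK =>
        (key m hm hm' hmK).trans (key n hn hn' hnK).symm
      intro m hm hm' hmK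
      by_cases h : m ∈ K
      · have : m = (a, b) ∨ m = (a, b + 1) :=
          or_iff_not_imp_left.2 (by simpa [h] using hmK)
        rcases this with rfl | rfl
        · exact hc.symm
        · simp only at hm'
          grind
      · exact hsep c (fun a b ha hb h => h1 a b ha hb (by simp [h]))
          (fun a b ha hb h => h2 a b ha hb (by simp [h])) _ _ hm hm' ha (hb.add_even even_two)
          h htop
    · exact hK.sdiff_free_top ha hb htop

/-- The centre of the half-open square of the grid of mesh `2` that contains a point. -/
noncomputable def gridSquare (z : ℂ) : ℤ × ℤ := (2 * ⌊z.re / 2⌋ + 1, 2 * ⌊z.im / 2⌋ + 1)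

lemma odd_gridSquare (z : ℂ) : Odd (gridSquare z).1 ∧ Odd (gridSquare z).2 :=
  ⟨⟨_, rfl⟩, ⟨_, rfl⟩⟩

lemma two_mul_floor_half_add_one_eq_iff {x : ℝ} {a : ℤ} (ha : Odd a) :
    2 * ⌊x / 2⌋ + 1 = a ↔ (a : ℝ) - 1 ≤ x ∧ x < a + 1 := by
  obtain ⟨n, rfl⟩ := ha
  have : 2 * ⌊x / 2⌋ + 1 = 2 * n + 1 ↔ ⌊x / 2⌋ = n := by lia
  rw [this, Int.floor_eq_iff]
  push_cast
  constructor <;> rintro ⟨h1, h2⟩ <;> constructor <;> linarith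

lemma gridSquare_eq_iff {z : ℂ} {m : ℤ × ℤ} (h1 : Odd m.1) (h2 : Odd m.2) :
    gridSquare z = m ↔ ((m.1 : ℝ) - 1 ≤ z.re ∧ z.re < m.1 + 1) ∧
      ((m.2 : ℝ) - 1 ≤ z.im ∧ z.im < m.2 + 1) := by
  rw [Prod.ext_iff, ← two_mul_floor_half_add_one_eq_iff h1,
    ← two_mul_floor_half_add_one_eq_iff h2, gridSquare]

lemma gridSquare_bounds (z : ℂ) :
    (((gridSquare z).1 : ℝ) - 1 ≤ z.re ∧ z.re < (gridSquare z).1 + 1) ∧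
      (((gridSquare z).2 : ℝ) - 1 ≤ z.im ∧ z.im < (gridSquare z).2 + 1) :=
  (gridSquare_eq_iff (odd_gridSquare z).1 (odd_gridSquare z).2).1 rfl

lemma mem_gridCell_gridSquare (z : ℂ) : z ∈ gridCell (gridSquare z) := by
  obtain ⟨⟨h1, h2⟩, h3, h4⟩ := gridSquare_bounds z
  obtain ⟨ho1, ho2⟩ := odd_gridSquare z
  rw [Int.odd_iff] at ho1 ho2
  refine ⟨?_, ?_⟩
  · rw [ho1, abs_le]
    push_cast
    constructor <;> linarith
  · rw [ho2, abs_le]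
    push_cast
    constructor <;> linarith

lemma dist_lt_three_of_gridSquare_eq {z w : ℂ} (h : gridSquare z = gridSquare w) :
    dist z w < 3 := by
  obtain ⟨⟨h1, h2⟩, h3, h4⟩ := gridSquare_bounds z
  obtain ⟨⟨h1', h2'⟩, h3', h4'⟩ := gridSquare_bounds w
  rw [h] at h1 h2 h3 h4
  rw [Complex.dist_eq_re_im]
  have h5 : (z.re - w.re) ^ 2 ≤ 2 ^ 2 := sq_le_sq' (by linarith) (by linarith)
  have h6 : (z.im - w.im) ^ 2 ≤ 2 ^ 2 := sq_le_sq' (by linarith) (by linarith)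
  rw [Real.sqrt_lt' (by norm_num)]
  linarith

/-- Every point of a closed square is a limit of points of the open square. -/
lemma exists_mem_ball_gridSquare_eq {z : ℂ} {m : ℤ × ℤ} (h1 : Odd m.1) (h2 : Odd m.2)
    (hre : |z.re - m.1| ≤ 1) (him : |z.im - m.2| ≤ 1) {r : ℝ} (hr : 0 < r) :
    ∃ w ∈ ball z r, gridSquare w = m := by
  obtain ⟨t, ht0, ht1, htr⟩ : ∃ t : ℝ, 0 < t ∧ t < 1 ∧ t * 3 < r :=
    ⟨min (1 / 2) (r / 4), by positivity, by linarith [min_le_left (1 / 2) (r / 4)],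
      by linarith [min_le_right (1 / 2) (r / 4)]⟩
  rw [abs_le] at hre him
  refine ⟨⟨z.re + t * (m.1 - z.re), z.im + t * (m.2 - z.im)⟩, ?_, ?_⟩
  · rw [mem_ball, Complex.dist_eq_re_im, Real.sqrt_lt' hr]
    simp only [add_sub_cancel_left]
    have h5 : (t * (m.1 - z.re)) ^ 2 ≤ t ^ 2 := sq_le_sq' (by nlinarith) (by nlinarith)
    have h6 : (t * (m.2 - z.im)) ^ 2 ≤ t ^ 2 := sq_le_sq' (by nlinarith) (by nlinarith)
    nlinarith
  · rw [gridSquare_eq_iff h1 h2]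
    simp only
    refine ⟨⟨?_, ?_⟩, ?_, ?_⟩ <;> nlinarith

/-- If a bounded set `U` has complement in a connected open set `O`, then the squares of the grid
which do not meet `O` form a nonseparating complex in `U`. -/
theorem exists_nonseparatingGrid {A U O : Set ℂ} (hO : IsOpen O) (hOc : IsPreconnected O)
    (hU : Bornology.IsBounded U) (hUO : Uᶜ ⊆ O) (hA : ∀ z ∈ O, ∀ a ∈ A, 3 ≤ dist z a) :
    ∃ K : Finset (ℤ × ℤ), IsGridComplex K ∧ IsNonseparatingGrid K ∧ A ⊆ gridUnion K ∧
      gridUnion K ⊆ U := by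
  set N : Set (ℤ × ℤ) := gridSquare '' O with hN
  set S : Set (ℤ × ℤ) := {f | Odd f.1 ∧ Odd f.2 ∧ f ∉ N} with hS
  have hSU : ∀ f ∈ S, (⟨f.1, f.2⟩ : ℂ) ∈ U := by
    rintro f ⟨h1, h2, hf⟩
    by_contra h
    refine hf ⟨_, hUO h, (gridSquare_eq_iff h1 h2).2 ?_⟩
    refine ⟨⟨?_, ?_⟩, ?_, ?_⟩ <;> simp only <;> linarith
  have hSfin : S.Finite := by
    obtain ⟨R, hR⟩ := hU.exists_norm_le
    refine ((Set.finite_Icc (-⌈R⌉) ⌈R⌉).prod (Set.finite_Icc (-⌈R⌉) ⌈R⌉)).subset fun f hf => ?_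
    have h := hR _ (hSU f hf)
    have h1 := abs_le.1 (((Complex.abs_re_le_norm _).trans h).trans (Int.le_ceil R))
    have h2 := abs_le.1 (((Complex.abs_im_le_norm _).trans h).trans (Int.le_ceil R))
    simp only at h1 h2
    exact ⟨⟨by exact_mod_cast h1.1, by exact_mod_cast h1.2⟩,
      ⟨by exact_mod_cast h2.1, by exact_mod_cast h2.2⟩⟩
  set K : Finset (ℤ × ℤ) := hSfin.toFinset.biUnion fun f =>
    Finset.Icc (f.1 - 1) (f.1 + 1) ×ˢ Finset.Icc (f.2 - 1) (f.2 + 1) with hKdef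
  have hmem : ∀ m : ℤ × ℤ, m ∈ K ↔ ∃ f : ℤ × ℤ, (Odd f.1 ∧ Odd f.2 ∧ f ∉ N) ∧
      (f.1 - 1 ≤ m.1 ∧ m.1 ≤ f.1 + 1) ∧ (f.2 - 1 ≤ m.2 ∧ m.2 ≤ f.2 + 1) := by
    intro m
    simp only [hKdef, Finset.mem_biUnion, Set.Finite.mem_toFinset, hS, Set.mem_ofPred_eq,
      Finset.mem_product, Finset.mem_Icc]
  have hsquare : ∀ m : ℤ × ℤ, Odd m.1 → Odd m.2 → m ∉ K → m ∈ N := by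
    intro m h1 h2 h
    by_contra hm
    exact h ((hmem m).2 ⟨m, ⟨h1, h2, hm⟩, by lia, by lia⟩)
  refine ⟨K, ?_, ?_, ?_, ?_⟩
  · intro m hm
    obtain ⟨f, hf, h1, h2⟩ := (hmem m).1 hm
    refine ⟨fun ho => ⟨(hmem _).2 ⟨f, hf, ?_, h2⟩, (hmem _).2 ⟨f, hf, ?_, h2⟩⟩,
      fun ho => ⟨(hmem _).2 ⟨f, hf, h1, ?_⟩, (hmem _).2 ⟨f, hf, h1, ?_⟩⟩⟩ <;>
    · obtain ⟨ho1, ho2, -⟩ := hf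
      clear_value S K
      clear * - ho ho1 ho2 h1 h2
      grind
  · intro c hc1 hc2
    have hre : ∀ z ∈ O, ∀ w ∈ O, z.im = w.im → |z.re - w.re| < 1 →
        c (gridSquare z) = c (gridSquare w) := by
      intro z hz w hw him hre
      wlog hle : (gridSquare z).1 ≤ (gridSquare w).1 generalizing z w
      · exact (this w hw z hz him.symm (by rwa [abs_sub_comm]) (le_of_not_ge hle)).symm
      have h2 : (gridSquare z).2 = (gridSquare w).2 := by simp [gridSquare, him]
      obtain ⟨hzo1, hzo2⟩ := odd_gridSquare z
      have hwo1 := (odd_gridSquare w).1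
      have hlt : (gridSquare w).1 < (gridSquare z).1 + 3 := by
        have h3 := (gridSquare_bounds w).1.1
        have h4 := (gridSquare_bounds z).1.2
        have h5 := (abs_lt.1 hre).1
        exact_mod_cast (by linarith : ((gridSquare w).1 : ℝ) < (gridSquare z).1 + 3)
      have hcase : (gridSquare w).1 = (gridSquare z).1 ∨
          (gridSquare w).1 = (gridSquare z).1 + 2 := by grind
      rcases hcase with h | h
      · rw [Prod.ext h.symm h2]
      · have hedge := hc2 ((gridSquare z).1 + 1) (gridSquare z).2 hzo1.add_one hzo2 ?_
        · rw [add_assoc, one_add_one_eq_two, add_sub_cancel_right, ← h] at hedge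
          nth_rw 1 [h2] at hedge
          exact hedge.symm
        · rw [hmem]
          rintro ⟨f, ⟨h3, h4, hf⟩, h5, h6⟩
          have h7 : f.2 = (gridSquare z).2 := by grind
          have h8 : f.1 = (gridSquare z).1 ∨ f.1 = (gridSquare w).1 := by grind
          rcases h8 with h8 | h8
          · exact hf ⟨z, hz, (Prod.ext h8 h7).symm⟩
          · exact hf ⟨w, hw, (Prod.ext h8 (h7.trans h2)).symm⟩
    have him : ∀ z ∈ O, ∀ w ∈ O, z.re = w.re → |z.im - w.im| < 1 →
        c (gridSquare z) = c (gridSquare w) := by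
      intro z hz w hw hre him
      wlog hle : (gridSquare z).2 ≤ (gridSquare w).2 generalizing z w
      · exact (this w hw z hz hre.symm (by rwa [abs_sub_comm]) (le_of_not_ge hle)).symm
      have h2 : (gridSquare z).1 = (gridSquare w).1 := by simp [gridSquare, hre]
      obtain ⟨hzo1, hzo2⟩ := odd_gridSquare z
      have hwo1 := (odd_gridSquare w).2
      have hlt : (gridSquare w).2 < (gridSquare z).2 + 3 := by
        have h3 := (gridSquare_bounds w).2.1
        have h4 := (gridSquare_bounds z).2.2
        have h5 := (abs_lt.1 him).1
        exact_mod_cast (by linarith : ((gridSquare w).2 : ℝ) < (gridSquare z).2 + 3)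
      have hcase : (gridSquare w).2 = (gridSquare z).2 ∨
          (gridSquare w).2 = (gridSquare z).2 + 2 := by grind
      rcases hcase with h | h
      · rw [Prod.ext h2 h.symm]
      · have hedge := hc1 (gridSquare z).1 ((gridSquare z).2 + 1) hzo1 hzo2.add_one ?_
        · rw [add_assoc, one_add_one_eq_two, add_sub_cancel_right, ← h] at hedge
          nth_rw 1 [h2] at hedge
          exact hedge.symm
        · rw [hmem]
          rintro ⟨f, ⟨h3, h4, hf⟩, h5, h6⟩
          have h7 : f.1 = (gridSquare z).1 := by grind
          have h8 : f.2 = (gridSquare z).2 ∨ f.2 = (gridSquare w).2 := by grind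
          rcases h8 with h8 | h8
          · exact hf ⟨z, hz, (Prod.ext h7 h8).symm⟩
          · exact hf ⟨w, hw, (Prod.ext (h7.trans h2) h8).symm⟩
    have hloc : ∀ z ∈ O, ∀ᶠ w in 𝓝[O] z, c (gridSquare z) = c (gridSquare w) := by
      intro z hz
      obtain ⟨r, hr, hball⟩ := Metric.isOpen_iff.1 hO z hz
      filter_upwards [mem_nhdsWithin_of_mem_nhds (ball_mem_nhds z (lt_min hr one_pos)),
        self_mem_nhdsWithin] with w hw hwO
      rw [mem_ball, dist_comm, Complex.dist_eq, lt_min_iff] at hw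
      have hs : (⟨w.re, z.im⟩ : ℂ) ∈ O := by
        refine hball (mem_ball'.2 (lt_of_le_of_lt ?_ hw.1))
        rw [Complex.dist_eq_re_im]
        simpa [Real.sqrt_sq_eq_abs] using Complex.abs_re_le_norm (z - w)
      exact (hre z hz _ hs rfl ((Complex.abs_re_le_norm (z - w)).trans_lt hw.2)).trans
        (him _ hs w hwO rfl ((Complex.abs_im_le_norm (z - w)).trans_lt hw.2))
    intro m n hm1 hm2 hn1 hn2 hm hn
    obtain ⟨z, hz, rfl⟩ := hsquare m hm1 hm2 hm
    obtain ⟨w, hw, rfl⟩ := hsquare n hn1 hn2 hn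
    exact hOc.induction₂ (fun z w => c (gridSquare z) = c (gridSquare w)) hloc
      (fun _ _ _ _ _ _ h h' => h.trans h') (fun _ _ _ _ h => h.symm) hz hw
  · intro a ha
    refine mem_gridUnion.2 ⟨gridSquare a, ?_, mem_gridCell_gridSquare a⟩
    by_contra h
    obtain ⟨z, hz, hza⟩ := hsquare _ (odd_gridSquare a).1 (odd_gridSquare a).2 h
    exact (hA z hz a ha).not_gt (dist_lt_three_of_gridSquare_eq hza)
  · intro z hz
    obtain ⟨m, hm, hre, him⟩ := mem_gridUnion.1 hz
    obtain ⟨f, ⟨ho1, ho2, hf⟩, h1, h2⟩ := (hmem m).1 hm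
    by_contra hzU
    obtain ⟨r, hr, hball⟩ := Metric.isOpen_iff.1 hO z (hUO hzU)
    have hcoord : ∀ {x : ℝ} {a b : ℤ}, |x - a| ≤ ((a % 2 : ℤ) : ℝ) → Odd b → b - 1 ≤ a →
        a ≤ b + 1 → |x - b| ≤ 1 := by
      intro x a b hx hb hba hab
      rcases Int.emod_two_eq_zero_or_one a with h | h
      · rw [h, Int.cast_zero, abs_nonpos_iff, sub_eq_zero] at hx
        rw [hx, abs_le]
        exact ⟨by exact_mod_cast (by lia : -1 ≤ a - b), by exact_mod_cast (by lia : a - b ≤ 1)⟩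
      · obtain rfl : a = b := by grind
        simpa [h] using hx
    obtain ⟨w, hw, hwf⟩ := exists_mem_ball_gridSquare_eq ho1 ho2
      (hcoord hre ho1 h1.1 h1.2) (hcoord him ho2 h2.1 h2.2) hr
    exact hf ⟨w, hball hw, hwf⟩

/-- The homeomorphisms `z ↦ p + r • z` of the plane pull dense sets back to dense sets. -/
lemma dense_setOf_add_smul_mem {D : Set ℂ} (hD : Dense D) (p : ℂ) {r : ℝ} (hr : r ≠ 0) :
    Dense {v : ℂ | p + r • v ∈ D} :=
  hD.preimage (((Homeomorph.smulOfNeZero r hr).trans (Homeomorph.addLeft p)).isOpenMap)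

lemma exists_homeomorph_mapsTo_compl_of_finite {E F U : Set ℂ} (hE : IsClosed E)
    (hE' : interior E = ∅) (hF : F.Finite) (hU : IsOpen U) (hUc : Uᶜ.Nonempty) (hFU : F ⊆ U) :
    ∃ h : ℂ ≃ₜ ℂ, (∀ z ∉ U, h z = z) ∧ Set.MapsTo h F Eᶜ := by
  have hpos : ∀ p ∈ F, infDist p Uᶜ ≠ 0 := fun p hp =>
    ((hU.isClosed_compl.notMem_iff_infDist_pos hUc).1 (by simpa using hFU hp)).ne'
  have hdense : Dense (⋂ p ∈ F, {v : ℂ | p + infDist p Uᶜ • v ∈ Eᶜ}) :=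
    dense_biInter_of_isOpen (fun p _ => hE.isOpen_compl.preimage (by fun_prop)) hF.countable
      fun p hp => dense_setOf_add_smul_mem (interior_eq_empty_iff_dense_compl.1 hE') p (hpos p hp)
  obtain ⟨v, hv, hvF⟩ := hdense.exists_mem_open isOpen_ball ⟨0, mem_ball_self one_pos⟩
  rw [mem_ball_zero_iff] at hvF
  obtain ⟨h, hh⟩ := exists_homeomorph_add_infDist_smul U hvF
  refine ⟨h, fun z hz => ?_, fun p hp => ?_⟩
  · rw [hh, infDist_zero_of_mem hz, zero_smul, add_zero]
  · rw [hh]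
    exact Set.mem_iInter₂.1 hv p hp

lemma isConnected_setOf_lt_norm {R : ℝ} (hR : 0 < R) : IsConnected {z : ℂ | R < ‖z‖} := by
  have : {z : ℂ | R < ‖z‖} = Complex.exp '' {z | Real.log R < z.re} := by
    ext z
    constructor
    · intro hz
      have hz0 : z ≠ 0 := norm_pos_iff.1 (hR.trans hz)
      exact ⟨Complex.log z, by simpa [Complex.log_re] using Real.log_lt_log hR hz,
        Complex.exp_log hz0⟩
    · rintro ⟨w, hw, rfl⟩
      simpa [Complex.norm_exp] using (Real.log_lt_iff_lt_exp hR).1 hw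
  rw [this]
  have hconn : IsConnected {z : ℂ | Real.log R < z.re} :=
    ⟨⟨(Real.log R + 1 : ℝ), by simp⟩, (convex_halfSpace_re_gt _).isPreconnected⟩
  exact hconn.image _ Complex.continuous_exp.continuousOn

/-- The complement of an open neighbourhood of a compact set with connected complement lies in
an open connected set at positive distance from the compact set. -/
lemma exists_isPreconnected_compl_subset {A U : Set ℂ} (hA : IsCompact A)
    (hAc : IsPreconnected Aᶜ) (hU : IsOpen U) (hUb : Bornology.IsBounded U) (hAU : A ⊆ U) :
    ∃ ρ > 0, ∃ O : Set ℂ, IsOpen O ∧ IsPreconnected O ∧ Uᶜ ⊆ O ∧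
      ∀ z ∈ O, ∀ a ∈ A, ρ ≤ dist z a := by
  obtain ⟨R, hR0, hR⟩ := hUb.exists_pos_norm_le
  set far : Set ℂ := {z | R + 1 < ‖z‖} with hfar
  have hfarc : IsConnected far := isConnected_setOf_lt_norm (by linarith)
  obtain ⟨z₀, hz₀⟩ := hfarc.nonempty
  have hfardist : ∀ z ∈ far, ∀ a ∈ A, 1 ≤ dist z a := by
    intro z hz a ha
    have h1 := hR a (hAU ha)
    have h2 : R + 1 < ‖z‖ := hz
    have h3 := norm_sub_norm_le z a
    rw [dist_eq_norm]
    linarith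
  let Q : Set ℂ → Prop := fun s => ∃ ρ > 0, ∃ O : Set ℂ, IsOpen O ∧ IsPreconnected O ∧
    far ⊆ O ∧ s ⊆ O ∧ ∀ z ∈ O, ∀ a ∈ A, ρ ≤ dist z a
  have hQfar : Q far := ⟨1, one_pos, far, isOpen_lt continuous_const continuous_norm,
    hfarc.isPreconnected, subset_rfl, subset_rfl, hfardist⟩
  have hQmono : ∀ ⦃s t : Set ℂ⦄, s ⊆ t → Q t → Q s := by
    rintro s t hst ⟨ρ, hρ, O, hO, hOc, hf, ht, hd⟩
    exact ⟨ρ, hρ, O, hO, hOc, hf, hst.trans ht, hd⟩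
  have hQunion : ∀ ⦃s t : Set ℂ⦄, Q s → Q t → Q (s ∪ t) := by
    rintro s t ⟨ρ, hρ, O, hO, hOc, hf, hs, hd⟩ ⟨ρ', hρ', O', hO', hOc', hf', ht, hd'⟩
    refine ⟨min ρ ρ', lt_min hρ hρ', O ∪ O', hO.union hO', hOc.union z₀ (hf hz₀) (hf' hz₀) hOc',
      hf.trans Set.subset_union_left, Set.union_subset_union hs ht, ?_⟩
    rintro z (hz | hz) a ha
    · exact (min_le_left _ _).trans (hd z hz a ha)
    · exact (min_le_right _ _).trans (hd' z hz a ha)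
  have hQball : ∀ {z w : ℂ} {r : ℝ}, 0 < r → ball z (2 * r) ⊆ Aᶜ → w ∈ ball z r →
      Q {w} → Q (ball z r) := by
    rintro z w r hr hball hw ⟨ρ, hρ, O, hO, hOc, hf, hwO, hd⟩
    refine ⟨min ρ r, lt_min hρ hr, O ∪ ball z r, hO.union isOpen_ball,
      hOc.union w (hwO rfl) hw (convex_ball z r).isPreconnected, hf.trans Set.subset_union_left,
      Set.subset_union_right, ?_⟩
    rintro x (hx | hx) a ha
    · exact (min_le_left _ _).trans (hd x hx a ha)
    · refine (min_le_right _ _).trans ?_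
      by_contra! h
      refine hball (mem_ball.2 ?_) ha
      have := dist_triangle a x z
      rw [mem_ball] at hx
      rw [dist_comm] at h
      linarith
  have hsmall : ∀ z ∈ Aᶜ, ∃ r > 0, ball z (2 * r) ⊆ Aᶜ := by
    intro z hz
    obtain ⟨r, hr, h⟩ := Metric.isOpen_iff.1 hA.isClosed.isOpen_compl z hz
    exact ⟨r / 2, by positivity, by rwa [mul_div_cancel₀ r two_ne_zero]⟩
  have hz₀A : z₀ ∈ Aᶜ := fun h => absurd (hfardist z₀ hz₀ z₀ h) (by simp)
  have hQpt : ∀ z ∈ Aᶜ, Q {z} := by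
    intro z hz
    refine (hAc.induction₂ (fun z w => Q {z} ↔ Q {w}) ?_ (fun _ _ _ _ _ _ h h' => h.trans h')
      (fun _ _ _ _ h => h.symm) hz₀A hz).1 (hQmono (by simpa using hz₀) hQfar)
    intro z hz
    obtain ⟨r, hr, hball⟩ := hsmall z hz
    filter_upwards [mem_nhdsWithin_of_mem_nhds (ball_mem_nhds z hr)] with w hw
    exact ⟨fun h => hQmono (by simpa using hw) (hQball hr hball (mem_ball_self hr) h),
      fun h => hQmono (by simpa using hr) (hQball hr hball hw h)⟩
  have hcompact : IsCompact (closedBall (0 : ℂ) (R + 1) ∩ Uᶜ) :=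
    (isCompact_closedBall 0 (R + 1)).inter_right hU.isClosed_compl
  obtain ⟨ρ, hρ, O, hO, hOc, hf, hs, hd⟩ : Q (closedBall (0 : ℂ) (R + 1) ∩ Uᶜ) := by
    refine hcompact.induction_on (hQmono (Set.empty_subset _) hQfar) hQmono hQunion ?_
    rintro z ⟨-, hz⟩
    have hzA : z ∈ Aᶜ := fun h => hz (hAU h)
    obtain ⟨r, hr, hball⟩ := hsmall z hzA
    exact ⟨ball z r, mem_nhdsWithin_of_mem_nhds (ball_mem_nhds z hr),
      hQball hr hball (mem_ball_self hr) (hQpt z hzA)⟩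
  refine ⟨ρ, hρ, O, hO, hOc, fun z hz => ?_, hd⟩
  rcases le_or_gt ‖z‖ (R + 1) with h | h
  · exact hs ⟨by simpa using h, hz⟩
  · exact hf h

/-- A compact set with connected complement shrinks to a finite set in any bounded
neighbourhood. -/
theorem exists_shrinksIn_finite {A U : Set ℂ} (hA : IsCompact A)
    (hAc : IsPreconnected Aᶜ) (hU : IsOpen U) (hUb : Bornology.IsBounded U) (hAU : A ⊆ U) :
    ∃ F : Set ℂ, F.Finite ∧ F ⊆ U ∧ ShrinksIn U A F := by
  obtain ⟨ρ, hρ, O, hO, hOc, hUO, hd⟩ := exists_isPreconnected_compl_subset hA hAc hU hUb hAU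
  set g : ℂ ≃ₜ ℂ := Homeomorph.smulOfNeZero (3 / ρ) (by positivity) with hg
  have hgz : ∀ z, g z = (3 / ρ) • z := fun z => rfl
  obtain ⟨K, hK, hsep, hAK, hKU⟩ := exists_nonseparatingGrid (A := g '' A) (U := g '' U)
    (O := g '' O) (g.isOpenMap _ hO) (hOc.image g g.continuous.continuousOn) (hUb.smul₀ (3 / ρ))
    (by rw [← Set.image_compl_eq g.bijective]; exact Set.image_mono hUO) (by
      rintro _ ⟨z, hz, rfl⟩ _ ⟨a, ha, rfl⟩
      have := hd z hz a ha
      rw [hgz, hgz, dist_smul₀, Real.norm_of_nonneg (by positivity), div_mul_eq_mul_div,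
        le_div_iff₀ hρ]
      linarith)
  obtain ⟨F, hF, hFK, hsF⟩ := hsep.exists_shrinksIn_finite hK (g.isOpenMap _ hU) hKU
  have hgU : g ⁻¹' (g '' U) = U := Set.preimage_image_eq U g.injective
  refine ⟨g ⁻¹' F, hF.preimage g.injective.injOn, ?_, fun W hW hFW => ?_⟩
  · exact (Set.preimage_mono (hFK.trans hKU)).trans hgU.subset
  · obtain ⟨h, hfix, hmaps⟩ := hsF.preimage g W hW hFW
    rw [hgU] at hfix
    exact ⟨h, hfix, fun a ha => hmaps (hAK ⟨a, ha, rfl⟩)⟩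

theorem exists_homeomorph_mapsTo_compl {A E U : Set ℂ} (hA : IsCompact A)
    (hAc : IsPreconnected Aᶜ) (hU : IsOpen U) (hUb : Bornology.IsBounded U) (hAU : A ⊆ U)
    (hE : IsClosed E) (hE' : interior E = ∅) :
    ∃ h : ℂ ≃ₜ ℂ, (∀ z ∉ U, h z = z) ∧ Set.MapsTo h A Eᶜ := by
  obtain ⟨F, hF, hFU, hsF⟩ := exists_shrinksIn_finite hA hAc hU hUb hAU
  have hUc : Uᶜ.Nonempty := Set.nonempty_compl.2 fun h =>
    NormedSpace.unbounded_univ ℝ ℂ (h ▸ hUb)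
  obtain ⟨g, hg, hgF⟩ := exists_homeomorph_mapsTo_compl_of_finite hE hE' hF hU hUc hFU
  obtain ⟨f, hf, hfA⟩ := hsF (g ⁻¹' Eᶜ) (hE.isOpen_compl.preimage g.continuous) hgF
  exact ⟨f.trans g, fun z hz => by simp [hf z hz, hg z hz], fun z hz => hfA hz⟩

/-- Finitely many compact sets with connected complements and disjoint bounded neighbourhoods can
be moved off a closed nowhere dense set within these neighbourhoods. -/
theorem exists_homeomorph_mapsTo_compl_of_pairwise_disjoint {ι : Type*} {A U : ι → Set ℂ}
    {E : Set ℂ} (hA : ∀ i, IsCompact (A i)) (hAc : ∀ i, IsPreconnected (A i)ᶜ)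
    (hU : ∀ i, IsOpen (U i)) (hUb : ∀ i, Bornology.IsBounded (U i)) (hAU : ∀ i, A i ⊆ U i)
    (hdisj : Pairwise (Function.onFun Disjoint U)) (hE : IsClosed E) (hE' : interior E = ∅)
    (s : Finset ι) :
    ∃ h : ℂ ≃ₜ ℂ, (∀ z, h z = z ∨ ∃ i ∈ s, z ∈ U i ∧ h z ∈ U i) ∧
      ∀ i ∈ s, Set.MapsTo h (A i) Eᶜ := by
  classical
  induction s using Finset.induction_on with
  | empty => exact ⟨Homeomorph.refl ℂ, fun z => Or.inl rfl, by simp⟩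
  | insert j s hj ih =>
    obtain ⟨g, hg, hgE⟩ := ih
    obtain ⟨f, hf, hfE⟩ :=
      exists_homeomorph_mapsTo_compl (hA j) (hAc j) (hU j) (hUb j) (hAU j) hE hE'
    have hfU : ∀ z ∈ U j, f z ∈ U j := fun z hz => by
      by_contra h
      rw [f.injective (hf _ h)] at h
      exact h hz
    have hne : ∀ i ∈ s, ∀ z ∈ U i, z ∉ U j := fun i hi z hz hzj =>
      Set.disjoint_left.1 (hdisj (ne_of_mem_of_not_mem hi hj)) hz hzj
    have hgj : ∀ z ∈ U j, g z = z := fun z hz =>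
      (hg z).resolve_right fun ⟨i, hi, hzi, _⟩ => hne i hi z hzi hz
    have hgf : ∀ i ∈ s, ∀ z ∈ U i, f z = z := fun i hi z hz => hf z (hne i hi z hz)
    refine ⟨f.trans g, fun z => ?_, fun i hi => ?_⟩
    · simp only [Homeomorph.trans_apply]
      by_cases hz : z ∈ U j
      · rw [hgj _ (hfU z hz)]
        exact Or.inr ⟨j, Finset.mem_insert_self j s, hz, hfU z hz⟩
      · rw [hf z hz]
        exact (hg z).imp_right fun ⟨i, hi, h⟩ => ⟨i, Finset.mem_insert_of_mem hi, h⟩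
    · intro z hz
      simp only [Homeomorph.trans_apply]
      rcases Finset.mem_insert.1 hi with rfl | hi
      · rw [hgj _ (hfU z (hAU i hz))]
        exact hfE hz
      · rw [hgf i hi z (hAU i hz)]
        exact hgE i hi hz

/-- Finitely many disjoint compact sets have disjoint thickenings of a common small radius. -/
lemma exists_pairwise_disjoint_thickening {ι : Type*} [Finite ι] {A : ι → Set ℂ}
    (hA : ∀ i, IsCompact (A i)) (hdisj : Pairwise (Function.onFun Disjoint A)) :
    ∃ δ > 0, Pairwise (Function.onFun Disjoint fun i => thickening δ (A i)) := by
  have h : ∀ p : ι × ι, ∀ᶠ δ in 𝓝[>] (0 : ℝ), p.1 ≠ p.2 →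
      Disjoint (thickening δ (A p.1)) (thickening δ (A p.2)) := by
    intro p
    by_cases hp : p.1 = p.2
    · simp [hp]
    · obtain ⟨δ, hδ, h⟩ := (hdisj hp).exists_thickenings (hA _) (hA _).isClosed
      filter_upwards [Ioc_mem_nhdsGT hδ] with η hη _
      exact h.mono (thickening_mono hη.2 _) (thickening_mono hη.2 _)
  obtain ⟨δ, h, hδ⟩ := ((Filter.eventually_all.2 h).and self_mem_nhdsWithin).exists
  exact ⟨δ, hδ, fun i j hij => h (i, j) hij⟩

/-- Perturbation lemma: given pairwise disjoint non-separating continua `A₁,…,A_m`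
of diameter less than `ε` and a closed nowhere dense set `E ⊆ ℂ`, there is a
homeomorphism `φ` of `ℂ`, uniformly `ε`-close to the identity, with `φ(E)` disjoint
from all the `Aᵢ`. -/
theorem stmt8 (ε : ℝ) (hε : 0 < ε) (m : ℕ) (A : Fin m → Set ℂ)
    (hcomp : ∀ i, IsCompact (A i)) (hconn : ∀ i, IsConnected (A i))
    (hcompl : ∀ i, IsConnected (A i)ᶜ)
    (hdisj : Pairwise (Function.onFun Disjoint A))
    (hdiam : ∀ i, diam (A i) < ε)
    (E : Set ℂ) (hE : IsClosed E) (hnd : interior E = ∅) :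
    ∃ φ : ℂ ≃ₜ ℂ, (∃ cst, cst < ε ∧ ∀ z, dist (φ z) z ≤ cst) ∧
      Disjoint (φ '' E) (⋃ i, A i) := by
  obtain ⟨d, hd0, hdε, hd⟩ : ∃ d : ℝ, 0 ≤ d ∧ d < ε ∧ ∀ i, diam (A i) ≤ d := by
    rcases isEmpty_or_nonempty (Fin m) with _ | _
    · exact ⟨0, le_rfl, hε, isEmptyElim⟩
    · obtain ⟨i, hi⟩ := Finite.exists_max fun i => diam (A i)
      exact ⟨_, diam_nonneg, hdiam i, hi⟩
  obtain ⟨δ₀, hδ₀, hdisj₀⟩ := exists_pairwise_disjoint_thickening hcomp hdisj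
  obtain ⟨δ, hδ, hδδ₀, hδε⟩ : ∃ δ > 0, δ ≤ δ₀ ∧ d + 2 * δ < ε :=
    ⟨min δ₀ ((ε - d) / 3), lt_min hδ₀ (by linarith), min_le_left _ _,
      by linarith [min_le_right δ₀ ((ε - d) / 3)]⟩
  obtain ⟨h, hh, hhE⟩ := exists_homeomorph_mapsTo_compl_of_pairwise_disjoint hcomp
    (fun i => (hcompl i).isPreconnected) (U := fun i => thickening δ (A i))
    (fun i => isOpen_thickening) (fun i => (hcomp i).isBounded.thickening)
    (fun i => self_subset_thickening hδ _)
    (fun i j hij => (hdisj₀ hij).mono (thickening_mono hδδ₀ _) (thickening_mono hδδ₀ _))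
    hE hnd Finset.univ
  refine ⟨h.symm, ⟨d + 2 * δ, hδε, fun z => ?_⟩, ?_⟩
  · obtain ⟨w, rfl⟩ := h.surjective z
    rw [Homeomorph.symm_apply_apply, dist_comm]
    rcases hh w with hw | ⟨i, -, hw, hw'⟩
    · rw [hw, dist_self]
      positivity
    · obtain ⟨a, ha, hwa⟩ := mem_thickening_iff.1 hw
      obtain ⟨b, hb, hwb⟩ := mem_thickening_iff.1 hw'
      have h1 := (dist_le_diam_of_mem (hcomp i).isBounded ha hb).trans (hd i)
      have h2 := dist_triangle4 w a b (h w)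
      rw [dist_comm b] at h2
      rw [dist_comm]
      linarith
  · rw [Set.disjoint_left]
    rintro _ ⟨w, hw, rfl⟩ hwA
    obtain ⟨i, hi⟩ := Set.mem_iUnion.1 hwA
    exact hhE i (Finset.mem_univ i) hi (by simpa using hw)
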